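/- Let E be a finite set of edges with positive integer length function l. If LSTDP(E) contains a DP-system whose graph is a bead broom graph with handle h, whose single initial vertex is the terminal vertex v_0 of h, and such that h contains an edge with maximal edge stabilization time, then LSTDP(E) contains a DP-system whose graph is a bead graph with all vertex degrees at most three and whose single initial vertex is a vertex of degree one. -/

import Mathlib

/-!
Common framework: metric multigraphs assembled from an edge set `E`
(`ends : E → Sym2 V` with distinct endpoints), walks, dynamic-point
systems, stabilization times, and structural graph notions.
-/

/-- Walks in a multigraph on vertices `V` with edge set `E` and endpoint map `ends`:
an alternating sequence of vertices and edges. -/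
inductive MGWalk {E V : Type} (ends : E → Sym2 V) : V → V → Type where
  | nil (a : V) : MGWalk ends a a
  | cons {a b c : V} (e : E) (h : ends e = s(a, b)) (tail : MGWalk ends b c) :
      MGWalk ends a c

namespace MGWalk

variable {E V : Type} {ends : E → Sym2 V}

/-- Length of a walk with respect to an edge-length function. -/
def length (l : E → ℝ) : ∀ {a b : V}, MGWalk ends a b → ℝ
  | _, _, nil _ => 0
  | _, _, cons e _ tail => l e + tail.length l

/-- The list of edge entries of a walk. -/
def edges : ∀ {a b : V}, MGWalk ends a b → List E
  | _, _, nil _ => []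
  | _, _, cons e _ tail => e :: tail.edges

end MGWalk

/-- A DP-system on a metric graph assembled from `E`: the vertex set is finite,
no edge is a loop, the multigraph is connected, and the set of initial vertices
is nonempty. -/
def IsDPSystem {E V : Type} (ends : E → Sym2 V) (S : Set V) : Prop :=
  Finite V ∧ (∀ e, ¬ (ends e).IsDiag) ∧ (∀ a b : V, Nonempty (MGWalk ends a b)) ∧
    S.Nonempty

/-- A dynamic point is present at time `t` at distance `s` from endpoint `x` of
edge `e` (on the arc leaving `x`) iff some walk from an initial vertex to `x`
has length `t - s`. -/
def IsPoint {E V : Type} (ends : E → Sym2 V) (l : E → ℝ) (S : Set V)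
    (t : ℝ) (e : E) (x : V) (s : ℝ) : Prop :=
  x ∈ ends e ∧ 0 ≤ s ∧ s < l e ∧
    ∃ v₀ ∈ S, ∃ w : MGWalk ends v₀ x, w.length l = t - s

/-- Number of dynamic points on edge `e` at time `t`. -/
noncomputable def NptsEdge {E V : Type} (ends : E → Sym2 V) (l : E → ℝ)
    (S : Set V) (e : E) (t : ℝ) : ℕ :=
  Set.ncard {p : V × ℝ | IsPoint ends l S t e p.1 p.2}

/-- Total number of dynamic points at time `t`. -/
noncomputable def Npts {E V : Type} (ends : E → Sym2 V) (l : E → ℝ)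
    (S : Set V) (t : ℝ) : ℕ :=
  Set.ncard {p : E × V × ℝ | IsPoint ends l S t p.1 p.2.1 p.2.2}

/-- `T` is a stabilization bound: `T ≥ 0` and the total number of points is
constant from `T` on. -/
def IsStabBound {E V : Type} (ends : E → Sym2 V) (l : E → ℝ) (S : Set V)
    (T : ℝ) : Prop :=
  0 ≤ T ∧ ∀ t ≥ T, Npts ends l S t = Npts ends l S T

/-- The stabilization time: the least stabilization bound. -/
noncomputable def stabTime {E V : Type} (ends : E → Sym2 V) (l : E → ℝ)
    (S : Set V) : ℝ :=
  sInf {T : ℝ | IsStabBound ends l S T}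

/-- `T` is a stabilization bound for edge `e`. -/
def IsEdgeStabBound {E V : Type} (ends : E → Sym2 V) (l : E → ℝ) (S : Set V)
    (e : E) (T : ℝ) : Prop :=
  0 ≤ T ∧ ∀ t ≥ T, NptsEdge ends l S e t = NptsEdge ends l S e T

/-- The stabilization time of edge `e`. -/
noncomputable def edgeStabTime {E V : Type} (ends : E → Sym2 V) (l : E → ℝ)
    (S : Set V) (e : E) : ℝ :=
  sInf {T : ℝ | IsEdgeStabBound ends l S e T}

/-- Membership in `LSTDP(E)` (given the underlying system is a DP-system):
its stabilization time is maximal among all DP-systems assembled from `E`. -/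
def IsMaxStab {E : Type} (l : E → ℝ) {V : Type} (ends : E → Sym2 V)
    (S : Set V) : Prop :=
  ∀ (V' : Type) (ends' : E → Sym2 V') (S' : Set V'),
    IsDPSystem ends' S' → stabTime ends' l S' ≤ stabTime ends l S

/-- Degree of vertex `x` in the subgraph with edge set `C`. -/
noncomputable def edgeDegree {E V : Type} (ends : E → Sym2 V) (C : Set E)
    (x : V) : ℕ :=
  Set.ncard {e ∈ C | x ∈ ends e}

/-- Degree of vertex `x` in the whole graph. -/
noncomputable def degree {E V : Type} (ends : E → Sym2 V) (x : V) : ℕ :=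
  Set.ncard {e : E | x ∈ ends e}

/-- `x` is a vertex of the subgraph with edge set `C`. -/
def OnEdgeSet {E V : Type} (ends : E → Sym2 V) (C : Set E) (x : V) : Prop :=
  ∃ e ∈ C, x ∈ ends e

/-- The subgraph with edge set `C` is connected. -/
def EdgeSetConn {E V : Type} (ends : E → Sym2 V) (C : Set E) : Prop :=
  ∀ a b : V, OnEdgeSet ends C a → OnEdgeSet ends C b →
    ∃ w : MGWalk ends a b, ∀ e ∈ w.edges, e ∈ C

/-- `C` is the edge set of a cycle: nonempty, connected, and every vertex of its
support has degree exactly two in it. -/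
def IsCycleSet {E V : Type} (ends : E → Sym2 V) (C : Set E) : Prop :=
  C.Nonempty ∧ EdgeSetConn ends C ∧
    ∀ x : V, OnEdgeSet ends C x → edgeDegree ends C x = 2

/-- A bead graph: no vertex lies on two distinct cycles. -/
def IsBead {E V : Type} (ends : E → Sym2 V) : Prop :=
  ∀ C₁ C₂ : Set E, IsCycleSet ends C₁ → IsCycleSet ends C₂ → C₁ ≠ C₂ →
    ∀ x : V, ¬ (OnEdgeSet ends C₁ x ∧ OnEdgeSet ends C₂ x)

/-- The graph has no cycles. -/
def IsAcyclicG {E V : Type} (ends : E → Sym2 V) : Prop :=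
  ∀ C : Set E, ¬ IsCycleSet ends C

/-- `H` is the edge set of a path subgraph: nonempty, connected, acyclic, and
all degrees within `H` are at most two. -/
def IsPathSet {E V : Type} (ends : E → Sym2 V) (H : Set E) : Prop :=
  H.Nonempty ∧ EdgeSetConn ends H ∧ (∀ C ⊆ H, ¬ IsCycleSet ends C) ∧
    ∀ x : V, edgeDegree ends H x ≤ 2

/-- `x` is a terminal vertex of the path subgraph `H`. -/
def IsHandleTerminal {E V : Type} (ends : E → Sym2 V) (H : Set E) (x : V) : Prop :=
  edgeDegree ends H x = 1

/-- The type `W(v, e)` of walks from `v` to an endpoint of edge `e`. -/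
def WalkTo {E V : Type} (ends : E → Sym2 V) (v : V) (e : E) : Type :=
  { p : Σ x : V, MGWalk ends v x // p.1 ∈ ends e }

/-- The relation `≈` on `W(v, e)`: walks with the same final endpoint are related
iff their lengths are congruent modulo `2·l(e)`; walks with different final
endpoints are related iff the difference of their lengths is congruent to
`l(e)` modulo `2·l(e)`. -/
def wapprox {E V : Type} (ends : E → Sym2 V) (l : E → ℝ) (v : V) (e : E)
    (w₁ w₂ : WalkTo ends v e) : Prop :=
  (w₁.1.1 = w₂.1.1 ∧
    ∃ k : ℤ, w₁.1.2.length l - w₂.1.2.length l = k * (2 * l e)) ∨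
  (w₁.1.1 ≠ w₂.1.1 ∧
    ∃ k : ℤ, w₁.1.2.length l - w₂.1.2.length l - l e = k * (2 * l e))

/-- `HasWalk ends l a b n`: some walk from `a` to `b` has length `n`. -/
inductive HasWalk {E V : Type} (ends : E → Sym2 V) (l : E → ℕ) (a : V) : V → ℕ → Prop where
  | nil : HasWalk ends l a a 0
  | snoc {b c : V} {n : ℕ} (e : E) (w : HasWalk ends l a b n) (h : ends e = s(b, c)) :
      HasWalk ends l a c (n + l e)

namespace HasWalk

variable {E V : Type} {ends : E → Sym2 V} {l : E → ℕ} {a b c : V} {m n : ℕ}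

theorem single (e : E) (h : ends e = s(a, b)) : HasWalk ends l a b (l e) := by
  simpa using HasWalk.nil.snoc (l := l) e h

theorem trans (h₁ : HasWalk ends l a b m) (h₂ : HasWalk ends l b c n) :
    HasWalk ends l a c (m + n) := by
  induction h₂ with
  | nil => simpa using h₁
  | snoc e _ h ih => simpa [add_assoc] using ih.snoc e h

theorem symm (h : HasWalk ends l a b n) : HasWalk ends l b a n := by
  induction h with
  | nil => exact nil
  | snoc e _ h ih =>
    rw [add_comm]
    exact (single e (by rw [h, Sym2.eq_swap])).trans ih

theorem repeat_closed (h : HasWalk ends l a a n) (k : ℕ) : HasWalk ends l a a (k * n) := by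
  induction k with
  | zero => simpa using nil
  | succ k ih => simpa [add_mul] using ih.trans h

theorem cast_eq (h : HasWalk ends l a b m) (hmn : m = n) : HasWalk ends l a b n := hmn ▸ h

theorem map {W : Type} {ends' : E → Sym2 W} {φ : V → W}
    (hφ : ∀ e, ends' e = (ends e).map φ) (h : HasWalk ends l a b n) :
    HasWalk ends' l (φ a) (φ b) n := by
  induction h with
  | nil => exact nil
  | snoc e _ h ih => exact ih.snoc e (by rw [hφ, h, Sym2.map_mk])

end HasWalk

theorem MGWalk.hasWalk {E V : Type} {ends : E → Sym2 V} (l : E → ℕ) {a b : V}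
    (w : MGWalk ends a b) :
    ∃ n : ℕ, w.length (fun e => (l e : ℝ)) = n ∧ HasWalk ends l a b n := by
  induction w with
  | nil a => exact ⟨0, by simp [MGWalk.length], .nil⟩
  | cons e h tail ih =>
    obtain ⟨n, hn, hw⟩ := ih
    exact ⟨l e + n, by simp [MGWalk.length, hn], (HasWalk.single e h).trans hw⟩

theorem HasWalk.exists_mgWalk {E V : Type} {ends : E → Sym2 V} {l : E → ℕ} {a b : V} {n : ℕ}
    (h : HasWalk ends l a b n) :
    ∃ w : MGWalk ends a b, w.length (fun e => (l e : ℝ)) = n := by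
  suffices H : ∀ c m (w : MGWalk ends b c), w.length (fun e => (l e : ℝ)) = (m : ℕ) →
      ∃ w : MGWalk ends a c, w.length (fun e => (l e : ℝ)) = (n + m : ℕ) by
    simpa using H b 0 (.nil b) (by simp [MGWalk.length])
  induction h with
  | nil => intro c m w hw; exact ⟨w, by simpa using hw⟩
  | @snoc x y n e _ h ih =>
    intro c m w hw
    obtain ⟨w', hw'⟩ := ih c (l e + m) (.cons e h w) (by simp [MGWalk.length, hw])
    exact ⟨w', by rw [hw', add_assoc]⟩

theorem IsDPSystem.exists_hasWalk {E V : Type} {ends : E → Sym2 V} {S : Set V}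
    (h : IsDPSystem ends S) (l : E → ℕ) (a b : V) : ∃ n, HasWalk ends l a b n := by
  obtain ⟨w⟩ := h.2.2.1 a b
  obtain ⟨n, -, hn⟩ := w.hasWalk l
  exact ⟨n, hn⟩

theorem isDPSystem_of_hasWalk {E V : Type} [Finite V] {ends : E → Sym2 V} {v₀ : V} {l : E → ℕ}
    (hd : ∀ e, ¬ (ends e).IsDiag) (h : ∀ v, ∃ n, HasWalk ends l v₀ v n) :
    IsDPSystem ends {v₀} := by
  refine ⟨‹_›, hd, fun a b => ?_, Set.singleton_nonempty _⟩
  obtain ⟨m, hm⟩ := h a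
  obtain ⟨n, hn⟩ := h b
  obtain ⟨w, -⟩ := (hm.symm.trans hn).exists_mgWalk
  exact ⟨w⟩

/-- A walk of length `n` from `v₀` arrives at an endpoint of the edge `e` joining `y` and `y'`,
creating a point of phase `r` on it. -/
def Arrives {E V : Type} (ends : E → Sym2 V) (l : E → ℕ) (v₀ : V) (e : E) (y y' : V)
    (n : ℕ) (r : ZMod (2 * l e)) : Prop :=
  (HasWalk ends l v₀ y n ∧ (n : ZMod (2 * l e)) = r) ∨
    (HasWalk ends l v₀ y' n ∧ ((n + l e : ℕ) : ZMod (2 * l e)) = r)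

/-- Some phase on the edge `e` occurs, but only from time `τ` on. -/
def HasLatePhase {E V : Type} (ends : E → Sym2 V) (l : E → ℕ) (v₀ : V) (e : E) (τ : ℕ) : Prop :=
  ∃ y y', ends e = s(y, y') ∧ ∃ r : ZMod (2 * l e),
    (∃ n, Arrives ends l v₀ e y y' n r) ∧ ∀ n, Arrives ends l v₀ e y y' n r → τ ≤ n

/-- The phases occurring on `e` up to time `t`. -/
def phases {E V : Type} (ends : E → Sym2 V) (l : E → ℕ) (v₀ : V) (e : E) (y y' : V)
    (t : ℝ) : Set (ZMod (2 * l e)) :=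
  {r | ∃ n : ℕ, (n : ℝ) ≤ t ∧ Arrives ends l v₀ e y y' n r}

theorem isPoint_iff {E V : Type} {ends : E → Sym2 V} {l : E → ℕ} {v₀ : V} {t : ℝ} {e : E}
    {x : V} {s : ℝ} :
    IsPoint ends (fun e => (l e : ℝ)) {v₀} t e x s ↔
      x ∈ ends e ∧ 0 ≤ s ∧ s < l e ∧ ∃ n : ℕ, HasWalk ends l v₀ x n ∧ (n : ℝ) = t - s := by
  constructor
  · rintro ⟨hx, h0, h1, v, rfl, w, hw⟩
    obtain ⟨n, hn, hW⟩ := w.hasWalk l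
    exact ⟨hx, h0, h1, n, hW, by rw [← hn, hw]⟩
  · rintro ⟨hx, h0, h1, n, hW, hn⟩
    obtain ⟨w, hw⟩ := hW.exists_mgWalk
    exact ⟨hx, h0, h1, v₀, rfl, w, by rw [hw, hn]⟩

section Counting

variable {E V : Type} {ends : E → Sym2 V} {l : E → ℕ} {v₀ : V} {e : E} {y y' : V}

theorem Arrives.flip {n : ℕ} {r : ZMod (2 * l e)} (h : Arrives ends l v₀ e y y' n r)
    (he : ends e = s(y, y')) : Arrives ends l v₀ e y y' (n + l e) r := by
  rcases h with ⟨h, rfl⟩ | ⟨h, rfl⟩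
  · refine Or.inr ⟨h.snoc e he, ?_⟩
    have : ((2 * l e : ℕ) : ZMod (2 * l e)) = 0 := ZMod.natCast_self _
    push_cast at this ⊢
    linear_combination this
  · exact Or.inl ⟨h.snoc e (by rw [he, Sym2.eq_swap]), rfl⟩

theorem Arrives.exists_recent {n : ℕ} {r : ZMod (2 * l e)} (h : Arrives ends l v₀ e y y' n r)
    (he : ends e = s(y, y')) (hl : 0 < l e) {t : ℝ} (hn : (n : ℝ) ≤ t) :
    ∃ m : ℕ, Arrives ends l v₀ e y y' m r ∧ (m : ℝ) ≤ t ∧ t < m + l e := by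
  by_contra hcon
  push Not at hcon
  have key : ∀ k : ℕ, Arrives ends l v₀ e y y' (n + k * l e) r ∧ ((n + k * l e : ℕ) : ℝ) ≤ t := by
    intro k
    induction k with
    | zero => simpa using ⟨h, hn⟩
    | succ k ih =>
      refine ⟨by simpa [add_mul, add_assoc] using ih.1.flip he, ?_⟩
      have := hcon _ ih.1 ih.2
      push_cast at this ⊢
      linarith
  obtain ⟨k, hk⟩ := exists_nat_gt t
  have h1 := (key k).2
  have h2 : (k : ℝ) ≤ ((n + k * l e : ℕ) : ℝ) := by
    exact_mod_cast le_trans (Nat.le_mul_of_pos_right k hl) (Nat.le_add_left _ _)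
  linarith

open Classical in
theorem nptsEdge_aux (he : ends e = s(y, y')) (hne : y ≠ y') (hl : 0 < l e) (t : ℝ) :
    {p : V × ℝ | IsPoint ends (fun e => (l e : ℝ)) {v₀} t e p.1 p.2}.Finite ∧
    NptsEdge ends (fun e => (l e : ℝ)) {v₀} e t = (phases ends l v₀ e y y' t).ncard := by
  set P : Set (V × ℝ) := {p : V × ℝ | IsPoint ends (fun e => (l e : ℝ)) {v₀} t e p.1 p.2} with hP
  let f : V × ℝ → ZMod (2 * l e) := fun p =>
    if p.1 = y then (⌊t - p.2⌋₊ : ZMod (2 * l e)) else ((⌊t - p.2⌋₊ + l e : ℕ) : ZMod (2 * l e))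
  have : NeZero (2 * l e) := ⟨by omega⟩
  have hinj : Set.InjOn f P := by
    rintro ⟨x₁, s₁⟩ h₁ ⟨x₂, s₂⟩ h₂ hf
    obtain ⟨hx₁, a₁, b₁, n₁, w₁, c₁⟩ := isPoint_iff.1 h₁
    obtain ⟨hx₂, a₂, b₂, n₂, w₂, c₂⟩ := isPoint_iff.1 h₂
    have d₁ : (n₁ : ℝ) < n₂ + l e := by dsimp only at *; linarith
    have d₂ : (n₂ : ℝ) < n₁ + l e := by dsimp only at *; linarith
    have d₁' : n₁ < n₂ + l e := by exact_mod_cast d₁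
    have d₂' : n₂ < n₁ + l e := by exact_mod_cast d₂
    simp only [f, ← c₁, ← c₂, Nat.floor_natCast] at hf
    dsimp only at *
    rw [he, Sym2.mem_iff] at hx₁ hx₂
    have fin : n₁ = n₂ → s₁ = s₂ := fun h => by rw [h] at c₁; linarith
    have modlem : ∀ a b : ℕ, (a : ZMod (2 * l e)) = (b : ZMod (2 * l e)) → a < b + 2 * l e →
        b < a + 2 * l e → a = b := by
      intro a b hab h1 h2
      have := (ZMod.intCast_eq_intCast_iff_dvd_sub (a : ℤ) (b : ℤ) (2 * l e)).1 (by simpa using hab)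
      obtain ⟨k, hk⟩ := this
      have hpos : (0 : ℤ) < ((2 * l e : ℕ) : ℤ) := by exact_mod_cast (by omega : 0 < 2 * l e)
      have hk1 : k < 1 := by
        by_contra hc
        have : ((2 * l e : ℕ) : ℤ) * 1 ≤ ((2 * l e : ℕ) : ℤ) * k :=
          mul_le_mul_of_nonneg_left (by omega) hpos.le
        push_cast at *
        omega
      have hk2 : -1 < k := by
        by_contra hc
        have : ((2 * l e : ℕ) : ℤ) * k ≤ ((2 * l e : ℕ) : ℤ) * (-1) :=
          mul_le_mul_of_nonneg_left (by omega) hpos.le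
        push_cast at *
        omega
      have : k = 0 := by omega
      subst this
      omega
    rcases hx₁ with rfl | rfl <;> rcases hx₂ with rfl | rfl
    · simp only [if_true] at hf
      rw [fin (modlem _ _ hf (by omega) (by omega))]
    · rw [if_pos rfl, if_neg hne.symm] at hf
      have := modlem _ _ hf (by omega) (by omega)
      omega
    · rw [if_pos rfl, if_neg hne.symm] at hf
      have := modlem _ _ hf (by omega) (by omega)
      omega
    · simp only [if_neg hne.symm] at hf
      have := modlem _ _ hf (by omega) (by omega)
      rw [fin (by omega)]
  have himg : f '' P = phases ends l v₀ e y y' t := by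
    ext r
    constructor
    · rintro ⟨⟨x, s⟩, hp, rfl⟩
      obtain ⟨hx, a, b, n, w, c⟩ := isPoint_iff.1 hp
      dsimp only at *
      rw [he, Sym2.mem_iff] at hx
      refine ⟨n, by linarith, ?_⟩
      simp only [f, ← c, Nat.floor_natCast]
      rcases hx with rfl | rfl
      · exact Or.inl ⟨w, by simp⟩
      · exact Or.inr ⟨w, by rw [if_neg hne.symm]⟩
    · rintro ⟨n, hn, hA⟩
      obtain ⟨m, hm, h1, h2⟩ := hA.exists_recent he hl hn
      have hs : t - (t - m) = (m : ℝ) := by ring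
      rcases hm with ⟨w, rfl⟩ | ⟨w, rfl⟩
      · refine ⟨(y, t - m), isPoint_iff.2 ⟨by simp [he], by simpa using h1, by dsimp; linarith, m, w,
          by ring⟩, ?_⟩
        simp only [f, hs, Nat.floor_natCast, if_true]
      · refine ⟨(y', t - m), isPoint_iff.2 ⟨by simp [he], by simpa using h1, by dsimp; linarith, m, w,
          by ring⟩, ?_⟩
        simp only [f, hs, Nat.floor_natCast]
        rw [if_neg hne.symm]
  refine ⟨Set.Finite.of_finite_image (Set.toFinite _) hinj, ?_⟩
  rw [NptsEdge, ← himg, hinj.ncard_image]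

theorem phases_mono {t t' : ℝ} (h : t ≤ t') :
    phases ends l v₀ e y y' t ⊆ phases ends l v₀ e y y' t' :=
  fun _ ⟨n, hn, hA⟩ => ⟨n, hn.trans h, hA⟩

end Counting

section Stabilization

variable {E V : Type} {ends : E → Sym2 V} {l : E → ℕ} {v₀ : V}

theorem exists_ends_eq (hd : ∀ e, ¬ (ends e).IsDiag) (e : E) :
    ∃ y y', ends e = s(y, y') ∧ y ≠ y' := by
  obtain ⟨y, y', h⟩ : ∃ y y', ends e = s(y, y') :=
    Sym2.inductionOn (ends e) fun a b => ⟨a, b, rfl⟩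
  exact ⟨y, y', h, fun hy => hd e (by rw [h]; exact hy)⟩

theorem nptsEdge_mono (hd : ∀ e, ¬ (ends e).IsDiag) (hl : ∀ e, 0 < l e) (e : E) :
    Monotone (NptsEdge ends (fun e => (l e : ℝ)) {v₀} e) := by
  intro t t' h
  obtain ⟨y, y', he, hne⟩ := exists_ends_eq hd e
  have : NeZero (2 * l e) := ⟨by have := hl e; omega⟩
  rw [(nptsEdge_aux he hne (hl e) t).2, (nptsEdge_aux he hne (hl e) t').2]
  exact Set.ncard_le_ncard (phases_mono h) (Set.toFinite _)

theorem npts_eq_sum [Fintype E] (hd : ∀ e, ¬ (ends e).IsDiag) (hl : ∀ e, 0 < l e) (t : ℝ) :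
    Npts ends (fun e => (l e : ℝ)) {v₀} t =
      ∑ e, NptsEdge ends (fun e => (l e : ℝ)) {v₀} e t := by
  have hfin : ∀ e, Finite {p : V × ℝ // IsPoint ends (fun e => (l e : ℝ)) {v₀} t e p.1 p.2} := by
    intro e
    obtain ⟨y, y', he, hne⟩ := exists_ends_eq hd e
    exact (nptsEdge_aux he hne (hl e) t).1.to_subtype
  have := Nat.card_sigma
    (β := fun e : E => {p : V × ℝ // IsPoint ends (fun e => (l e : ℝ)) {v₀} t e p.1 p.2})
  change Nat.card {p : E × V × ℝ // _} = ∑ e, Nat.card {p : V × ℝ // _}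
  refine Eq.trans (Nat.card_congr ?_) this
  exact
    { toFun := fun p => ⟨p.1.1, p.1.2, p.2⟩
      invFun := fun p => ⟨(p.1, p.2.1), p.2.2⟩
      left_inv := fun _ => rfl
      right_inv := fun _ => rfl }

theorem IsStabBound.isEdgeStabBound [Fintype E] (hd : ∀ e, ¬ (ends e).IsDiag) (hl : ∀ e, 0 < l e)
    {T : ℝ} (h : IsStabBound ends (fun e => (l e : ℝ)) {v₀} T) (e : E) :
    IsEdgeStabBound ends (fun e => (l e : ℝ)) {v₀} e T := by
  refine ⟨h.1, fun t ht => ?_⟩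
  have hs := h.2 t ht
  rw [npts_eq_sum hd hl, npts_eq_sum hd hl, eq_comm,
    Finset.sum_eq_sum_iff_of_le fun i _ => nptsEdge_mono hd hl i ht] at hs
  exact (hs e (Finset.mem_univ _)).symm

theorem isStabBound_of_forall_edge [Fintype E] (hd : ∀ e, ¬ (ends e).IsDiag)
    (hl : ∀ e, 0 < l e) {T : ℝ} (h0 : 0 ≤ T)
    (h : ∀ e, IsEdgeStabBound ends (fun e => (l e : ℝ)) {v₀} e T) :
    IsStabBound ends (fun e => (l e : ℝ)) {v₀} T := by
  refine ⟨h0, fun t ht => ?_⟩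
  rw [npts_eq_sum hd hl, npts_eq_sum hd hl]
  exact Finset.sum_congr rfl fun e _ => (h e).2 t ht

/-- Some phase occurring on `e` is the last to occur, and `e` is stable from then on. -/
theorem exists_hasLatePhase (hD : IsDPSystem ends {v₀}) (hl : ∀ e, 0 < l e) (e : E) :
    ∃ τ : ℕ, HasLatePhase ends l v₀ e τ ∧
      IsEdgeStabBound ends (fun e => (l e : ℝ)) {v₀} e τ := by
  classical
  obtain ⟨y, y', he, hne⟩ := exists_ends_eq hD.2.1 e
  have : NeZero (2 * l e) := ⟨by have := hl e; omega⟩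
  let R : Set (ZMod (2 * l e)) := {r | ∃ n, Arrives ends l v₀ e y y' n r}
  let φ : ZMod (2 * l e) → ℕ := fun r => sInf {n | Arrives ends l v₀ e y y' n r}
  obtain ⟨n₀, hn₀⟩ := hD.exists_hasWalk l v₀ y
  obtain ⟨r, hr, hmax⟩ := Set.exists_max_image R φ (Set.toFinite _) ⟨_, n₀, Or.inl ⟨hn₀, rfl⟩⟩
  refine ⟨φ r, ⟨y, y', he, r, hr, fun n hn => Nat.sInf_le hn⟩, Nat.cast_nonneg _, fun t ht => ?_⟩
  rw [(nptsEdge_aux he hne (hl e) t).2, (nptsEdge_aux he hne (hl e) _).2]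
  congr 1
  refine (phases_mono ht).antisymm' ?_
  rintro q ⟨n, -, hn⟩
  exact ⟨φ q, by exact_mod_cast hmax q ⟨n, hn⟩, Nat.sInf_mem (s := {n | Arrives ends l v₀ e y y' n q}) ⟨n, hn⟩⟩

theorem HasLatePhase.le_of_isEdgeStabBound (hD : IsDPSystem ends {v₀}) (hl : ∀ e, 0 < l e) {e : E}
    {τ : ℕ} (h : HasLatePhase ends l v₀ e τ) {T : ℝ}
    (hT : IsEdgeStabBound ends (fun e => (l e : ℝ)) {v₀} e T) : (τ : ℝ) ≤ T := by
  obtain ⟨y, y', he, r, ⟨n, hn⟩, hr⟩ := h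
  have hne : y ≠ y' := fun hy => hD.2.1 e (by rw [he]; exact hy)
  have : NeZero (2 * l e) := ⟨by have := hl e; omega⟩
  have h1 := hT.2 (max T n) (le_max_left _ _)
  rw [(nptsEdge_aux he hne (hl e) _).2, (nptsEdge_aux he hne (hl e) _).2] at h1
  have h2 := Set.eq_of_subset_of_ncard_le
    (phases_mono (ends := ends) (l := l) (v₀ := v₀) (e := e) (y := y) (y' := y')
      (le_max_left T (n : ℝ))) h1.le (Set.toFinite _)
  have h3 : r ∈ phases ends l v₀ e y y' T := by
    rw [h2]
    exact ⟨n, le_max_right _ _, hn⟩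
  obtain ⟨m, hm, hA⟩ := h3
  exact le_trans (by exact_mod_cast hr m hA) hm

theorem exists_isStabBound [Fintype E] (hD : IsDPSystem ends {v₀}) (hl : ∀ e, 0 < l e) :
    ∃ T, IsStabBound ends (fun e => (l e : ℝ)) {v₀} T := by
  choose τ _ hb using exists_hasLatePhase hD hl
  refine ⟨((∑ e, τ e : ℕ) : ℝ), isStabBound_of_forall_edge hD.2.1 hl (Nat.cast_nonneg _)
    fun e => ⟨Nat.cast_nonneg _, fun t ht => ?_⟩⟩
  have hle : (τ e : ℝ) ≤ ((∑ e, τ e : ℕ) : ℝ) := by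
    exact_mod_cast Finset.single_le_sum (fun i _ => Nat.zero_le (τ i)) (Finset.mem_univ e)
  rw [(hb e).2 t (hle.trans ht), (hb e).2 _ hle]

theorem HasLatePhase.le_stabTime [Fintype E] (hD : IsDPSystem ends {v₀}) (hl : ∀ e, 0 < l e)
    {e : E} {τ : ℕ} (h : HasLatePhase ends l v₀ e τ) :
    (τ : ℝ) ≤ stabTime ends (fun e => (l e : ℝ)) {v₀} :=
  le_csInf (exists_isStabBound hD hl) fun _ hT =>
    h.le_of_isEdgeStabBound hD hl (hT.isEdgeStabBound hD.2.1 hl e)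

/-- An edge with maximal edge stabilization time has a phase which does not occur before the
stabilization time of the whole system. -/
theorem exists_hasLatePhase_of_max [Fintype E] (hD : IsDPSystem ends {v₀}) (hl : ∀ e, 0 < l e)
    {e : E} (hmax : ∀ e', edgeStabTime ends (fun e => (l e : ℝ)) {v₀} e' ≤
      edgeStabTime ends (fun e => (l e : ℝ)) {v₀} e) :
    ∃ τ : ℕ, HasLatePhase ends l v₀ e τ ∧ stabTime ends (fun e => (l e : ℝ)) {v₀} ≤ τ := by
  obtain ⟨τ, hτ, hb⟩ := exists_hasLatePhase hD hl e
  refine ⟨τ, hτ, csInf_le ⟨0, fun _ h => h.1⟩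
    (isStabBound_of_forall_edge hD.2.1 hl (Nat.cast_nonneg _) fun e' => ?_)⟩
  obtain ⟨τ', hτ', hb'⟩ := exists_hasLatePhase hD hl e'
  have h1 : (τ' : ℝ) ≤ edgeStabTime ends (fun e => (l e : ℝ)) {v₀} e' :=
    le_csInf ⟨_, hb'⟩ fun _ hT => hτ'.le_of_isEdgeStabBound hD hl hT
  have h2 : edgeStabTime ends (fun e => (l e : ℝ)) {v₀} e ≤ τ := csInf_le ⟨0, fun _ h => h.1⟩ hb
  have h3 : (τ' : ℝ) ≤ τ := h1.trans ((hmax e').trans h2)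
  exact ⟨Nat.cast_nonneg _, fun t ht => by rw [hb'.2 t (h3.trans ht), hb'.2 _ h3]⟩

end Stabilization

/-- Adjacency through an edge of `F`. -/
def EStep {E V : Type} (ends : E → Sym2 V) (F : Set E) (a b : V) : Prop :=
  ∃ e ∈ F, ends e = s(a, b)

/-- `b` can be reached from `a` through edges of `F`. -/
abbrev Reach {E V : Type} (ends : E → Sym2 V) (F : Set E) : V → V → Prop :=
  Relation.ReflTransGen (EStep ends F)

/-- The simple graph of adjacencies through edges of `F`. -/
def stepGraph {E V : Type} (ends : E → Sym2 V) (F : Set E) : SimpleGraph V where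
  Adj a b := a ≠ b ∧ EStep ends F a b
  symm := ⟨fun _ _ ⟨h, e, he, h'⟩ => ⟨h.symm, e, he, by rw [h', Sym2.eq_swap]⟩⟩
  loopless := ⟨fun _ h => h.1 rfl⟩

/-- `p 0, d 0, p 1, …, d (n - 1), p n` is a path without repeated vertices. -/
structure IsSimplePath {E V : Type} (ends : E → Sym2 V) (p : ℕ → V) (d : ℕ → E) (n : ℕ) : Prop where
  ends_eq : ∀ i < n, ends (d i) = s(p i, p (i + 1))
  inj : ∀ i ≤ n, ∀ j ≤ n, p i = p j → i = j

section Reachability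

variable {E V : Type} {ends : E → Sym2 V} {F : Set E} {a b c : V}

theorem EStep.symm (h : EStep ends F a b) : EStep ends F b a := by
  obtain ⟨e, he, h⟩ := h
  exact ⟨e, he, by rw [h, Sym2.eq_swap]⟩

theorem Reach.symm (h : Reach ends F a b) : Reach ends F b a := by
  induction h with
  | refl => exact .refl
  | tail _ h ih => exact .head h.symm ih

theorem Reach.mono {F' : Set E} (hF : F ⊆ F') (h : Reach ends F a b) : Reach ends F' a b :=
  Relation.ReflTransGen.mono (fun _ _ ⟨e, he, h⟩ => ⟨e, hF he, h⟩) _ _ h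

theorem Reach.single {e : E} (he : e ∈ F) (h : ends e = s(a, b)) : Reach ends F a b :=
  Relation.ReflTransGen.single ⟨e, he, h⟩

theorem reach_iff_exists_mgWalk :
    Reach ends F a b ↔ ∃ w : MGWalk ends a b, ∀ e ∈ w.edges, e ∈ F := by
  constructor
  · intro h
    induction h using Relation.ReflTransGen.head_induction_on with
    | refl => exact ⟨.nil b, by simp [MGWalk.edges]⟩
    | head h _ ih =>
      obtain ⟨e, he, h⟩ := h
      obtain ⟨w, hw⟩ := ih
      exact ⟨.cons e h w, by simpa [MGWalk.edges] using ⟨he, hw⟩⟩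
  · rintro ⟨w, hw⟩
    induction w with
    | nil => exact .refl
    | cons e h tail ih =>
      simp only [MGWalk.edges, List.mem_cons, forall_eq_or_imp] at hw
      exact .head ⟨e, hw.1, h⟩ (ih hw.2)

theorem HasWalk.reach {l : E → ℕ} {n : ℕ} (h : HasWalk ends l a b n) :
    Reach ends Set.univ a b := by
  induction h with
  | nil => exact .refl
  | snoc e _ h ih => exact ih.tail ⟨e, trivial, h⟩

theorem Reach.exists_hasWalk (l : E → ℕ) (h : Reach ends F a b) : ∃ n, HasWalk ends l a b n := by
  induction h with
  | refl => exact ⟨0, .nil⟩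
  | tail _ h ih =>
    obtain ⟨n, hn⟩ := ih
    obtain ⟨e, -, he⟩ := h
    exact ⟨_, hn.snoc e he⟩

theorem Reach.reachable (hd : ∀ e, ¬ (ends e).IsDiag) (h : Reach ends F a b) :
    (stepGraph ends F).Reachable a b := by
  rw [SimpleGraph.reachable_iff_reflTransGen]
  refine Relation.ReflTransGen.mono (fun a b hab => ⟨?_, hab⟩) _ _ h
  obtain ⟨e, -, he⟩ := hab
  rintro rfl
  exact hd e (by rw [he]; exact rfl)

theorem Reach.exists_isSimplePath [Nonempty E] (hd : ∀ e, ¬ (ends e).IsDiag)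
    (h : Reach ends F a b) : ∃ p d n, IsSimplePath ends p d n ∧ p 0 = a ∧ p n = b ∧
      ∀ i < n, d i ∈ F := by
  classical
  obtain ⟨w, hw⟩ := (h.reachable hd).exists_isPath
  have hs : ∀ i, ∃ e, i < w.length → e ∈ F ∧ ends e = s(w.getVert i, w.getVert (i + 1)) := by
    intro i
    by_cases hi : i < w.length
    · obtain ⟨-, e, he, h⟩ := w.adj_getVert_succ hi
      exact ⟨e, fun _ => ⟨he, h⟩⟩
    · exact ⟨Classical.arbitrary E, fun h => absurd h hi⟩
  choose d hd' using hs
  exact ⟨w.getVert, d, w.length, ⟨fun i hi => (hd' i hi).2,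
    fun i hi j hj hij => hw.getVert_injOn hi hj hij⟩, w.getVert_zero, w.getVert_length,
    fun i hi => (hd' i hi).1⟩

/-- A walk either passes through `x` or uses no edge at `x`. -/
theorem HasWalk.split_or_reach {l : E → ℕ} {n : ℕ} (h : HasWalk ends l a b n) (x : V) :
    (∃ k₁ k₂, HasWalk ends l a x k₁ ∧ HasWalk ends l x b k₂ ∧ k₁ + k₂ = n) ∨
      Reach ends {e | x ∉ ends e} a b := by
  induction h with
  | nil => exact Or.inr .refl
  | @snoc b c n e w h ih =>
    rcases ih with ⟨k₁, k₂, h₁, h₂, rfl⟩ | ih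
    · exact Or.inl ⟨k₁, k₂ + l e, h₁, h₂.snoc e h, by ring⟩
    by_cases hb : x = b
    · subst hb
      exact Or.inl ⟨n, l e, w, .single e h, rfl⟩
    by_cases hc : x = c
    · subst hc
      exact Or.inl ⟨n + l e, 0, w.snoc e h, .nil, rfl⟩
    · exact Or.inr (ih.tail ⟨e, by simp [h, hb, hc], h⟩)

end Reachability

namespace IsSimplePath

variable {E V : Type} {ends : E → Sym2 V} {p : ℕ → V} {d : ℕ → E} {n : ℕ}

theorem mem_ends_iff (h : IsSimplePath ends p d n) {i j : ℕ} (hi : i ≤ n) (hj : j < n) :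
    p i ∈ ends (d j) ↔ i = j ∨ i = j + 1 := by
  rw [h.ends_eq j hj, Sym2.mem_iff]
  exact ⟨fun H => H.imp (h.inj _ hi _ hj.le) (h.inj _ hi _ hj),
    fun H => H.imp (congrArg p) (congrArg p)⟩

theorem edge_inj (h : IsSimplePath ends p d n) {i j : ℕ} (hi : i < n) (hj : j < n)
    (hij : d i = d j) : i = j := by
  have h1 := (h.mem_ends_iff hi.le hj).1 (by rw [← hij, h.ends_eq i hi]; simp)
  have h2 := (h.mem_ends_iff hj.le hi).1 (by rw [hij, h.ends_eq j hj]; simp)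
  omega

theorem reach (h : IsSimplePath ends p d n) {F : Set E} {i j : ℕ} (hij : i ≤ j) (hj : j ≤ n)
    (hF : ∀ k, i ≤ k → k < j → d k ∈ F) : Reach ends F (p i) (p j) := by
  induction j, hij using Nat.le_induction with
  | base => exact .refl
  | succ j hij ih =>
    exact (ih (by omega) fun k h1 h2 => hF k h1 (by omega)).tail
      ⟨d j, hF j hij (by omega), h.ends_eq j (by omega)⟩

theorem take (h : IsSimplePath ends p d n) {k : ℕ} (hk : k ≤ n) : IsSimplePath ends p d k :=
  ⟨fun i hi => h.ends_eq i (by omega), fun i hi j hj => h.inj i (by omega) j (by omega)⟩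

theorem reverse (h : IsSimplePath ends p d n) :
    IsSimplePath ends (fun i => p (n - i)) (fun i => d (n - 1 - i)) n := by
  refine ⟨fun i hi => ?_, fun i hi j hj hij => ?_⟩
  · have := h.ends_eq (n - 1 - i) (by omega)
    rw [show n - 1 - i + 1 = n - i by omega] at this
    rw [this, Sym2.eq_swap, show n - 1 - i = n - (i + 1) by omega]
  · have := h.inj _ (by omega) _ (by omega) hij
    omega

theorem congr_ends {ends' : E → Sym2 V} (h : IsSimplePath ends p d n)
    (he : ∀ i < n, ends' (d i) = ends (d i)) : IsSimplePath ends' p d n :=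
  ⟨fun i hi => by rw [he i hi, h.ends_eq i hi], h.inj⟩

/-- Prepend an edge to a simple path. -/
theorem cons (h : IsSimplePath ends p d n) {v : V} {e : E} (he : ends e = s(v, p 0))
    (hv : ∀ i ≤ n, p i ≠ v) :
    IsSimplePath ends (fun i => Nat.casesOn i v p) (fun i => Nat.casesOn i e d) (n + 1) := by
  refine ⟨fun i hi => ?_, fun i hi j hj hij => ?_⟩
  · cases i with
    | zero => exact he
    | succ i => exact h.ends_eq i (by omega)
  · cases i with
    | zero =>
      cases j with
      | zero => rfl
      | succ j => exact absurd hij.symm (hv j (by omega))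
    | succ i =>
      cases j with
      | zero => exact absurd hij (hv i (by omega))
      | succ j => rw [h.inj i (by omega) j (by omega) hij]

/-- Append an edge to a simple path. -/
theorem exists_concat (h : IsSimplePath ends p d n) {v : V} {e : E} (he : ends e = s(p n, v))
    (hv : ∀ i ≤ n, p i ≠ v) :
    ∃ p' d', IsSimplePath ends p' d' (n + 1) ∧ (∀ i ≤ n, p' i = p i) ∧ p' (n + 1) = v ∧
      (∀ i < n, d' i = d i) ∧ d' n = e := by
  refine ⟨fun i => if i ≤ n then p i else v, fun i => if i < n then d i else e,
    ⟨fun i hi => ?_, fun i hi j hj hij => ?_⟩, fun i hi => if_pos hi, if_neg (by omega),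
    fun i hi => if_pos hi, if_neg (by omega)⟩
  · by_cases hin : i < n
    · simp only [hin, if_true, hin.le, show i + 1 ≤ n by omega]
      exact h.ends_eq i hin
    · obtain rfl : i = n := by omega
      simpa using he
  · by_cases hin : i ≤ n <;> by_cases hjn : j ≤ n <;>
      simp only [hin, hjn, if_true, if_false] at hij
    · exact h.inj i hin j hjn hij
    · exact absurd hij (hv i hin)
    · exact absurd hij.symm (hv j hjn)
    · omega

end IsSimplePath

section Cycles

variable {E V : Type} {ends : E → Sym2 V}

theorem edgeSetConn_iff {C : Set E} : EdgeSetConn ends C ↔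
    ∀ a b, OnEdgeSet ends C a → OnEdgeSet ends C b → Reach ends C a b := by
  simp only [EdgeSetConn, reach_iff_exists_mgWalk]

theorem IsCycleSet.exists_pair {C : Set E} (h : IsCycleSet ends C) {x : V}
    (hx : OnEdgeSet ends C x) :
    ∃ e f, e ≠ f ∧ e ∈ C ∧ f ∈ C ∧ x ∈ ends e ∧ x ∈ ends f ∧
      ∀ g ∈ C, x ∈ ends g → g = e ∨ g = f := by
  obtain ⟨e, f, hne, hS⟩ := Set.ncard_eq_two.1 (h.2.2 x hx)
  have he : e ∈ {e ∈ C | x ∈ ends e} := by rw [hS]; simp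
  have hf : f ∈ {e ∈ C | x ∈ ends e} := by rw [hS]; simp
  refine ⟨e, f, hne, he.1, hf.1, he.2, hf.2, fun g hg hxg => ?_⟩
  have : g ∈ {e ∈ C | x ∈ ends e} := ⟨hg, hxg⟩
  rwa [hS] at this

theorem IsSimplePath.isCycleSet {p : ℕ → V} {d : ℕ → E} {n : ℕ} (h : IsSimplePath ends p d n)
    (hn : 0 < n) {c : E} (hc : ends c = s(p n, p 0)) (hcd : ∀ i < n, d i ≠ c) :
    IsCycleSet ends {e | e = c ∨ ∃ i < n, d i = e} := by
  have hon : ∀ x, OnEdgeSet ends {e | e = c ∨ ∃ i < n, d i = e} x → ∃ i ≤ n, x = p i := by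
    rintro x ⟨e, rfl | ⟨i, hi, rfl⟩, hx⟩
    · rw [hc, Sym2.mem_iff] at hx
      rcases hx with rfl | rfl
      exacts [⟨n, le_rfl, rfl⟩, ⟨0, Nat.zero_le _, rfl⟩]
    · rw [h.ends_eq i hi, Sym2.mem_iff] at hx
      rcases hx with rfl | rfl
      exacts [⟨i, hi.le, rfl⟩, ⟨i + 1, hi, rfl⟩]
  have hmc : ∀ i ≤ n, (p i ∈ ends c ↔ i = n ∨ i = 0) := by
    intro i hi
    rw [hc, Sym2.mem_iff]
    exact ⟨fun H => H.imp (h.inj _ hi _ le_rfl) (h.inj _ hi _ (Nat.zero_le _)),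
      fun H => H.imp (congrArg p) (congrArg p)⟩
  refine ⟨⟨c, Or.inl rfl⟩, edgeSetConn_iff.2 fun a b ha hb => ?_, fun x hx => ?_⟩
  · obtain ⟨i, hi, rfl⟩ := hon a ha
    obtain ⟨j, hj, rfl⟩ := hon b hb
    exact (h.reach (Nat.zero_le i) hi fun k _ hk => Or.inr ⟨k, by omega, rfl⟩).symm.trans
      (h.reach (Nat.zero_le j) hj fun k _ hk => Or.inr ⟨k, by omega, rfl⟩)
  · obtain ⟨i, hi, rfl⟩ := hon x hx
    rw [edgeDegree, Set.ncard_eq_two]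
    by_cases h0 : i = 0
    · refine ⟨c, d 0, (hcd 0 hn).symm, Set.ext fun e => ⟨?_, ?_⟩⟩
      · rintro ⟨rfl | ⟨j, hj, rfl⟩, he⟩
        · exact Or.inl rfl
        · rw [h.mem_ends_iff hi hj] at he
          obtain rfl : j = 0 := by omega
          exact Or.inr rfl
      · rintro (rfl | rfl)
        · exact ⟨Or.inl rfl, (hmc i hi).2 (Or.inr h0)⟩
        · exact ⟨Or.inr ⟨0, hn, rfl⟩, (h.mem_ends_iff hi hn).2 (Or.inl h0)⟩
    by_cases h1 : i = n
    · refine ⟨c, d (n - 1), (hcd _ (by omega)).symm, Set.ext fun e => ⟨?_, ?_⟩⟩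
      · rintro ⟨rfl | ⟨j, hj, rfl⟩, he⟩
        · exact Or.inl rfl
        · rw [h.mem_ends_iff hi hj] at he
          obtain rfl : j = n - 1 := by omega
          exact Or.inr rfl
      · rintro (rfl | rfl)
        · exact ⟨Or.inl rfl, (hmc i hi).2 (Or.inl h1)⟩
        · exact ⟨Or.inr ⟨n - 1, by omega, rfl⟩, (h.mem_ends_iff hi (by omega)).2 (by omega)⟩
    · refine ⟨d i, d (i - 1), fun H => ?_, Set.ext fun e => ⟨?_, ?_⟩⟩
      · have := h.edge_inj (by omega) (by omega) H
        omega
      · rintro ⟨rfl | ⟨j, hj, rfl⟩, he⟩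
        · rw [hmc i hi] at he
          omega
        · rw [h.mem_ends_iff hi hj] at he
          rcases he with rfl | rfl
          · exact Or.inl rfl
          · exact Or.inr (by simp)
      · rintro (rfl | rfl)
        · exact ⟨Or.inr ⟨i, by omega, rfl⟩, (h.mem_ends_iff hi (by omega)).2 (Or.inl rfl)⟩
        · exact ⟨Or.inr ⟨i - 1, by omega, rfl⟩, (h.mem_ends_iff hi (by omega)).2 (by omega)⟩

/-- An edge lying on no cycle is a bridge. -/
theorem not_reach_of_forall_notMem_cycle (hd : ∀ e, ¬ (ends e).IsDiag) {f : E}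
    (hf : ∀ C, IsCycleSet ends C → f ∉ C) {a b : V} (he : ends f = s(a, b)) :
    ¬ Reach ends {e | e ≠ f} a b := by
  intro h
  have : Nonempty E := ⟨f⟩
  obtain ⟨p, d, n, hp, rfl, rfl, hF⟩ := h.exists_isSimplePath hd
  have hn : 0 < n := by
    rcases Nat.eq_zero_or_pos n with rfl | hn
    · exact absurd (by rw [he]; exact rfl) (hd f)
    · exact hn
  exact hf _ (hp.isCycleSet hn (he.trans Sym2.eq_swap) hF) (Or.inl rfl)

/-- Two edges at `v` whose other endpoints are connected off `v` lie on a common cycle. -/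
theorem exists_path_of_reach_off (hd : ∀ e, ¬ (ends e).IsDiag) {e f : E} (hef : e ≠ f) {v a b : V}
    (he : ends e = s(v, a)) (hf : ends f = s(v, b)) (h : Reach ends {g | v ∉ ends g} a b) :
    ∃ p d n, IsSimplePath ends p d n ∧ 0 < n ∧ p 0 = v ∧ p n = b ∧ d 0 = e ∧
      ∀ i < n, d i ≠ f := by
  have : Nonempty E := ⟨e⟩
  have hva : v ≠ a := fun hv => hd e (by rw [he]; exact hv)
  obtain ⟨p, d, n, hp, rfl, rfl, hF⟩ := h.exists_isSimplePath hd
  have hv : ∀ i ≤ n, p i ≠ v := by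
    intro i hi hiv
    cases i with
    | zero => exact hva hiv.symm
    | succ i =>
      refine hF i (by omega) ?_
      rw [hp.ends_eq i (by omega), hiv]
      simp
  refine ⟨_, _, n + 1, hp.cons he hv, n.succ_pos, rfl, rfl, rfl, fun i hi => ?_⟩
  cases i with
  | zero => exact hef
  | succ i =>
    intro h
    refine hF i (by omega) ?_
    rw [show d i = f from h, hf]
    simp

theorem IsCycleSet.map {W : Type} {ends' : E → Sym2 W} {C : Set E} {φ : V → W}
    (hC : IsCycleSet ends C) (hφ : ∀ e ∈ C, ends' e = (ends e).map φ)
    (hinj : ∀ a b, OnEdgeSet ends C a → OnEdgeSet ends C b → φ a = φ b → a = b) :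
    IsCycleSet ends' C ∧ ∀ w, OnEdgeSet ends' C w → ∃ v, OnEdgeSet ends C v ∧ φ v = w := by
  have hon : ∀ w, OnEdgeSet ends' C w → ∃ v, OnEdgeSet ends C v ∧ φ v = w := by
    rintro w ⟨e, he, hw⟩
    rw [hφ e he, Sym2.mem_map] at hw
    obtain ⟨v, hv, rfl⟩ := hw
    exact ⟨v, ⟨e, he, hv⟩, rfl⟩
  refine ⟨⟨hC.1, edgeSetConn_iff.2 fun a b ha hb => ?_, fun w hw => ?_⟩, hon⟩
  · obtain ⟨a, ha', rfl⟩ := hon a ha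
    obtain ⟨b, hb', rfl⟩ := hon b hb
    refine Relation.ReflTransGen.lift (p := EStep ends' C) φ (fun u v ⟨e, he, h⟩ => ⟨e, he, ?_⟩)
      _ _ (edgeSetConn_iff.1 hC.2.1 a b ha' hb')
    rw [hφ e he, h, Sym2.map_mk]
  · obtain ⟨v, hv, rfl⟩ := hon w hw
    rw [← hC.2.2 v hv, edgeDegree, edgeDegree]
    congr 1
    ext e
    refine and_congr_right fun he => ?_
    rw [hφ e he, Sym2.mem_map]
    exact ⟨fun ⟨u, hu, huv⟩ => hinj u v ⟨e, he, hu⟩ hv huv ▸ hu, fun h => ⟨v, h, rfl⟩⟩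

theorem sum_edgeDegree [Fintype V] [Finite E] (hd : ∀ e, ¬ (ends e).IsDiag) (K : Set E) :
    ∑ x : V, edgeDegree ends K x = 2 * K.ncard := by
  classical
  have := Fintype.ofFinite E
  have h1 : ∀ x, edgeDegree ends K x = ∑ e ∈ K.toFinset, if x ∈ ends e then 1 else 0 := by
    intro x
    rw [← Finset.card_filter, edgeDegree, ← Set.ncard_coe_finset]
    congr 1
    ext e
    simp
  simp_rw [h1]
  rw [Finset.sum_comm, Set.ncard_eq_toFinset_card', mul_comm, ← smul_eq_mul]
  refine Finset.sum_eq_card_nsmul fun e _ => ?_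
  obtain ⟨y, y', he, hne⟩ := exists_ends_eq hd e
  rw [← Finset.card_filter, ← Finset.card_pair hne]
  congr 1
  ext x
  simp [he]

/-- If edges inside and outside `M` meet only in `y`, no cycle has edges of both kinds. -/
theorem IsCycleSet.subset_or_disjoint [Finite V] [Finite E] (hd : ∀ e, ¬ (ends e).IsDiag)
    {M C : Set E} {y : V} (hM : ∀ e ∈ M, ∀ f ∉ M, ∀ v, v ∈ ends e → v ∈ ends f → v = y)
    (hC : IsCycleSet ends C) : C ⊆ M ∨ ∀ e ∈ C, e ∉ M := by
  classical
  have := Fintype.ofFinite V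
  by_contra hcon
  push Not at hcon
  obtain ⟨hnot, e₁, he₁, he₁M⟩ := hcon
  obtain ⟨e₂, he₂, he₂M⟩ := Set.not_subset.1 hnot
  have hcross : ∃ e ∈ C, e ∈ M ∧ ∃ f ∈ C, f ∉ M ∧ ∃ v, v ∈ ends e ∧ v ∈ ends f := by
    by_contra hno
    push Not at hno
    obtain ⟨a, a', ha, -⟩ := exists_ends_eq hd e₁
    obtain ⟨b, b', hb, -⟩ := exists_ends_eq hd e₂
    have hr := edgeSetConn_iff.1 hC.2.1 a b ⟨e₁, he₁, by simp [ha]⟩ ⟨e₂, he₂, by simp [hb]⟩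
    have hU : ∃ e ∈ C, e ∈ M ∧ b ∈ ends e := by
      clear hb
      induction hr with
      | refl => exact ⟨e₁, he₁, he₁M, by simp [ha]⟩
      | tail _ h ih =>
        obtain ⟨e, he, heM, hu⟩ := ih
        obtain ⟨f, hf, hfe⟩ := h
        by_cases hfM : f ∈ M
        · exact ⟨f, hf, hfM, by simp [hfe]⟩
        · exact absurd (by simp [hfe]) (hno e he heM f hf hfM _ hu)
    obtain ⟨e, he, heM, hbe⟩ := hU
    exact hno e he heM e₂ he₂ he₂M b hbe (by simp [hb])
  obtain ⟨e, he, heM, f, hf, hfM, v, hve, hvf⟩ := hcross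
  obtain rfl := hM e heM f hfM v hve hvf
  have hone : edgeDegree ends (C ∩ M) v = 1 := by
    obtain ⟨g₁, g₂, hne, h1, h2, h3, h4, h5⟩ := hC.exists_pair ⟨e, he, hve⟩
    rw [edgeDegree, Set.ncard_eq_one]
    refine ⟨e, Set.ext fun g => ⟨?_, ?_⟩⟩
    · rintro ⟨⟨hg, hgM⟩, hvg⟩
      have a1 := h5 g hg hvg
      have a2 := h5 e he hve
      have a3 := h5 f hf hvf
      have a4 : g ≠ f := fun h => hfM (h ▸ hgM)
      have a5 : e ≠ f := fun h => hfM (h ▸ heM)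
      change g = e
      grind
    · rintro rfl
      exact ⟨⟨he, heM⟩, hve⟩
  have hother : ∀ x, x ≠ v → Even (edgeDegree ends (C ∩ M) x) := by
    intro x hx
    by_cases hxM : ∃ g ∈ C ∩ M, x ∈ ends g
    · obtain ⟨g, ⟨hgC, hgM⟩, hxg⟩ := hxM
      have : edgeDegree ends (C ∩ M) x = edgeDegree ends C x := by
        rw [edgeDegree, edgeDegree]
        congr 1
        ext k
        refine ⟨fun ⟨⟨h1, _⟩, h3⟩ => ⟨h1, h3⟩, fun ⟨h1, h3⟩ => ⟨⟨h1, ?_⟩, h3⟩⟩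
        by_contra hkM
        exact hx (hM g hgM k hkM x hxg h3)
      rw [this, hC.2.2 x ⟨g, hgC, hxg⟩]
      exact even_two
    · have : edgeDegree ends (C ∩ M) x = 0 := by
        rw [edgeDegree]
        convert Set.ncard_empty E
        ext k
        simp only [Set.mem_ofPred_eq, Set.mem_empty_iff_false, iff_false]
        exact fun h => hxM ⟨k, h.1, h.2⟩
      rw [this]
      exact Even.zero
  have hsum := sum_edgeDegree hd (C ∩ M)
  rw [← Finset.add_sum_erase _ _ (Finset.mem_univ v), hone] at hsum
  have := Finset.even_sum (s := Finset.univ.erase v) (fun x => edgeDegree ends (C ∩ M) x)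
    fun x hx => hother x (Finset.ne_of_mem_erase hx)
  obtain ⟨k, hk⟩ := this
  omega

end Cycles

/-- The edges with an endpoint in `B`. -/
def touching {E V : Type} (ends : E → Sym2 V) (B : Set V) : Set E :=
  {e | ∃ b ∈ B, b ∈ ends e}

open Classical in
/-- The multigraph in which the part `B` hanging at `x` is moved to `y`. -/
noncomputable def reattach {E V : Type} (ends : E → Sym2 V) (B : Set V) (x y : V) (e : E) :
    Sym2 V :=
  if e ∈ touching ends B then (ends e).map (fun v => if v = x then y else v) else ends e

/-- The part `B` is attached to the rest of the graph, which contains `y`, only at `x`. -/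
structure HangsAt {E V : Type} (ends : E → Sym2 V) (B : Set V) (x y : V) : Prop where
  left_notMem : x ∉ B
  right_notMem : y ∉ B
  mem_or_eq : ∀ e a b, ends e = s(a, b) → a ∈ B → b ∈ B ∨ b = x

section Reattach

variable {E V : Type} {ends : E → Sym2 V} {B : Set V} {x y : V} {l : E → ℕ}

theorem notMem_touching {e : E} {u v : V} (he : ends e = s(u, v)) (hu : u ∉ B) (hv : v ∉ B) :
    e ∉ touching ends B := by
  rintro ⟨b, hb, hbe⟩
  rw [he, Sym2.mem_iff] at hbe
  rcases hbe with rfl | rfl <;> contradiction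

theorem reattach_of_notMem {e : E} (he : e ∉ touching ends B) : reattach ends B x y e = ends e :=
  if_neg he

theorem mem_reattach_iff {e : E} {v : V} (hx : v ≠ x) (hy : v ≠ y) :
    v ∈ reattach ends B x y e ↔ v ∈ ends e := by
  by_cases he : e ∈ touching ends B
  · rw [reattach, if_pos he, Sym2.mem_map]
    constructor
    · rintro ⟨u, hu, huv⟩
      split_ifs at huv with h
      · exact absurd huv.symm hy
      · exact huv ▸ hu
    · exact fun h => ⟨v, h, if_neg hx⟩
  · rw [reattach_of_notMem he]

namespace HangsAt

variable (H : HangsAt ends B x y)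
include H

theorem reattach_of_mem_of_mem {e : E} {u v : V} (he : ends e = s(u, v)) (hu : u ∈ B)
    (hv : v ∈ B) : reattach ends B x y e = s(u, v) := by
  rw [reattach, if_pos ⟨u, hu, by simp [he]⟩, he, Sym2.map_mk,
    if_neg fun h : u = x => H.left_notMem (h ▸ hu), if_neg fun h : v = x => H.left_notMem (h ▸ hv)]

theorem reattach_of_eq_of_mem {e : E} {v : V} (he : ends e = s(x, v)) (hv : v ∈ B) :
    reattach ends B x y e = s(y, v) := by
  rw [reattach, if_pos ⟨v, hv, by simp [he]⟩, he, Sym2.map_mk, if_pos rfl,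
    if_neg fun h : v = x => H.left_notMem (h ▸ hv)]

theorem reattach_cases {e : E} {u v : V} (he : reattach ends B x y e = s(u, v)) :
    (u ∉ B ∧ v ∉ B ∧ ends e = s(u, v) ∧ e ∉ touching ends B) ∨
      (u ∈ B ∧ v ∈ B ∧ ends e = s(u, v)) ∨
      (u = y ∧ v ∈ B ∧ ends e = s(x, v)) ∨ (v = y ∧ u ∈ B ∧ ends e = s(u, x)) := by
  obtain ⟨a, b, hab⟩ : ∃ a b, ends e = s(a, b) :=
    Sym2.inductionOn (ends e) fun a b => ⟨a, b, rfl⟩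
  by_cases ha : a ∈ B <;> by_cases hb : b ∈ B
  · rw [H.reattach_of_mem_of_mem hab ha hb, Sym2.eq_iff] at he
    rcases he with ⟨rfl, rfl⟩ | ⟨rfl, rfl⟩
    · exact Or.inr (Or.inl ⟨ha, hb, hab⟩)
    · exact Or.inr (Or.inl ⟨hb, ha, hab.trans Sym2.eq_swap⟩)
  · obtain rfl := (H.mem_or_eq e a b hab ha).resolve_left hb
    rw [H.reattach_of_eq_of_mem (hab.trans Sym2.eq_swap) ha, Sym2.eq_iff] at he
    rcases he with ⟨rfl, rfl⟩ | ⟨rfl, rfl⟩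
    · exact Or.inr (Or.inr (Or.inl ⟨rfl, ha, hab.trans Sym2.eq_swap⟩))
    · exact Or.inr (Or.inr (Or.inr ⟨rfl, ha, hab⟩))
  · obtain rfl := (H.mem_or_eq e b a (hab.trans Sym2.eq_swap) hb).resolve_left ha
    rw [H.reattach_of_eq_of_mem hab hb, Sym2.eq_iff] at he
    rcases he with ⟨rfl, rfl⟩ | ⟨rfl, rfl⟩
    · exact Or.inr (Or.inr (Or.inl ⟨rfl, hb, hab⟩))
    · exact Or.inr (Or.inr (Or.inr ⟨rfl, hb, hab.trans Sym2.eq_swap⟩))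
  · have hM := notMem_touching hab ha hb
    rw [reattach_of_notMem hM, hab, Sym2.eq_iff] at he
    rcases he with ⟨rfl, rfl⟩ | ⟨rfl, rfl⟩
    · exact Or.inl ⟨ha, hb, hab, hM⟩
    · exact Or.inl ⟨hb, ha, hab.trans Sym2.eq_swap, hM⟩

theorem mem_reattach_of_mem_touching {e : E} {v : V} (he : e ∈ touching ends B)
    (hv : v ∈ reattach ends B x y e) : (v ∈ B ∧ v ∈ ends e) ∨ (v = y ∧ x ∈ ends e) := by
  obtain ⟨u, hu⟩ := Sym2.mem_iff_exists.1 hv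
  rcases H.reattach_cases hu with ⟨-, -, -, h⟩ | ⟨h, -, h'⟩ | ⟨h, -, h'⟩ | ⟨-, h, h'⟩
  · exact absurd he h
  · exact Or.inl ⟨h, by simp [h']⟩
  · exact Or.inr ⟨h, by simp [h']⟩
  · exact Or.inl ⟨h, by simp [h']⟩

theorem not_isDiag (hd : ∀ e, ¬ (ends e).IsDiag) (e : E) : ¬ (reattach ends B x y e).IsDiag := by
  obtain ⟨u, v, h⟩ : ∃ u v, reattach ends B x y e = s(u, v) :=
    Sym2.inductionOn (reattach ends B x y e) fun a b => ⟨a, b, rfl⟩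
  rw [h, Sym2.mk_isDiag_iff]
  rintro rfl
  rcases H.reattach_cases h with ⟨-, -, h, -⟩ | ⟨-, -, h⟩ | ⟨rfl, h, -⟩ | ⟨rfl, h, -⟩
  · exact hd e (by rw [h]; exact rfl)
  · exact hd e (by rw [h]; exact rfl)
  · exact H.right_notMem h
  · exact H.right_notMem h

theorem hasWalk_of_reattach {v₀ v : V} (h₀ : v₀ ∉ B)
    (hdom : ∀ n, HasWalk ends l v₀ y n →
      ∃ k₁ k₂, HasWalk ends l v₀ x k₁ ∧ HasWalk ends l x y k₂ ∧ k₁ + k₂ = n)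
    {m : ℕ} (h : HasWalk (reattach ends B x y) l v₀ v m) :
    (v ∉ B → HasWalk ends l v₀ v m) ∧
      (v ∈ B → ∃ k₁ k₂ k₃, HasWalk ends l v₀ x k₁ ∧ HasWalk ends l x y k₂ ∧
        HasWalk ends l x v k₃ ∧ k₁ + k₂ + k₃ = m) := by
  induction h with
  | nil => exact ⟨fun _ => .nil, fun h => absurd h h₀⟩
  | @snoc b c n e _ h ih =>
    rcases H.reattach_cases h with ⟨hb, hc, h, -⟩ | ⟨hb, hc, h⟩ | ⟨rfl, hc, h⟩ | ⟨rfl, hb, h⟩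
    · exact ⟨fun _ => (ih.1 hb).snoc e h, fun h => absurd h hc⟩
    · obtain ⟨k₁, k₂, k₃, h₁, h₂, h₃, rfl⟩ := ih.2 hb
      exact ⟨fun h => absurd hc h, fun _ => ⟨k₁, k₂, _, h₁, h₂, h₃.snoc e h, by ring⟩⟩
    · obtain ⟨k₁, k₂, h₁, h₂, rfl⟩ := hdom n (ih.1 H.right_notMem)
      exact ⟨fun h => absurd hc h, fun _ => ⟨k₁, k₂, _, h₁, h₂, .single e h, rfl⟩⟩
    · obtain ⟨k₁, k₂, k₃, h₁, h₂, h₃, rfl⟩ := ih.2 hb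
      exact ⟨fun _ => (((h₁.trans h₃).snoc e h).trans h₂).cast_eq (by ring),
        fun h => absurd h H.right_notMem⟩

theorem exists_hasWalk_reattach {v₀ v : V} (h₀ : v₀ ∉ B) {d : ℕ}
    (hq : HasWalk (reattach ends B x y) l x y d) {N : ℕ} (hN : 0 < N) {m : ℕ}
    (h : HasWalk ends l v₀ v m) :
    (v ∉ B → ∃ m', HasWalk (reattach ends B x y) l v₀ v m' ∧ (m' : ZMod N) = m) ∧
      (v ∈ B → ∃ m', HasWalk (reattach ends B x y) l v₀ v m' ∧ (m' : ZMod N) = m + d) := by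
  induction h with
  | nil => exact ⟨fun _ => ⟨0, .nil, rfl⟩, fun h => absurd h h₀⟩
  | @snoc b c n e _ h ih =>
    by_cases hb : b ∈ B <;> by_cases hc : c ∈ B
    · refine ⟨fun h => absurd hc h, fun _ => ?_⟩
      obtain ⟨m', hm', hmod⟩ := ih.2 hb
      exact ⟨_, hm'.snoc e (H.reattach_of_mem_of_mem h hb hc), by push_cast; rw [hmod]; ring⟩
    · refine ⟨fun _ => ?_, fun h => absurd h hc⟩
      obtain rfl := (H.mem_or_eq e b c h hb).resolve_left hc
      obtain ⟨m', hm', hmod⟩ := ih.2 hb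
      have h1 := hm'.snoc e ((H.reattach_of_eq_of_mem (h.trans Sym2.eq_swap) hb).trans Sym2.eq_swap)
      refine ⟨_, (h1.trans hq.symm).trans ((hq.trans hq.symm).repeat_closed (N - 1)), ?_⟩
      obtain ⟨k, rfl⟩ : ∃ k, N = k + 1 := ⟨N - 1, by omega⟩
      have : ((k + 1 : ℕ) : ZMod (k + 1)) = 0 := ZMod.natCast_self _
      push_cast at this
      push_cast [Nat.add_sub_cancel]
      rw [hmod]
      linear_combination 2 * (d : ZMod (k + 1)) * this
    · refine ⟨fun h => absurd hc h, fun _ => ?_⟩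
      obtain rfl := (H.mem_or_eq e c b (h.trans Sym2.eq_swap) hc).resolve_left hb
      obtain ⟨m', hm', hmod⟩ := ih.1 hb
      refine ⟨_, (hm'.trans hq).snoc e (H.reattach_of_eq_of_mem h hc), ?_⟩
      push_cast
      rw [hmod]
      ring
    · refine ⟨fun _ => ?_, fun h => absurd h hc⟩
      obtain ⟨m', hm', hmod⟩ := ih.1 hb
      exact ⟨_, hm'.snoc e ((reattach_of_notMem (notMem_touching h hb hc)).trans h),
        by push_cast; rw [hmod]⟩

theorem isDPSystem {v₀ : V} (hD : IsDPSystem ends {v₀}) (h₀ : v₀ ∉ B) {d : ℕ}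
    (hq : HasWalk (reattach ends B x y) l x y d) : IsDPSystem (reattach ends B x y) {v₀} := by
  have := hD.1
  refine isDPSystem_of_hasWalk (l := l) (H.not_isDiag hD.2.1) fun v => ?_
  obtain ⟨n, hn⟩ := hD.exists_hasWalk l v₀ v
  have h := H.exists_hasWalk_reattach h₀ hq one_pos hn
  by_cases hv : v ∈ B
  · exact (h.2 hv).imp fun _ h => h.1
  · exact (h.1 hv).imp fun _ h => h.1

theorem hasLatePhase {v₀ : V} (h₀ : v₀ ∉ B) (hl : ∀ e, 0 < l e) {d : ℕ}
    (hq : HasWalk (reattach ends B x y) l x y d)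
    (hdom : ∀ n, HasWalk ends l v₀ y n →
      ∃ k₁ k₂, HasWalk ends l v₀ x k₁ ∧ HasWalk ends l x y k₂ ∧ k₁ + k₂ = n)
    {e : E} (he : e ∉ touching ends B) {τ : ℕ} (h : HasLatePhase ends l v₀ e τ) :
    HasLatePhase (reattach ends B x y) l v₀ e τ := by
  obtain ⟨t, t', hends, r, ⟨n, hn⟩, hr⟩ := h
  have ht : t ∉ B := fun h => he ⟨t, h, by simp [hends]⟩
  have ht' : t' ∉ B := fun h => he ⟨t', h, by simp [hends]⟩
  refine ⟨t, t', (reattach_of_notMem he).trans hends, r, ?_, fun n hn => hr n ?_⟩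
  · have hN : 0 < 2 * l e := by have := hl e; omega
    rcases hn with ⟨hw, rfl⟩ | ⟨hw, rfl⟩
    · obtain ⟨m', hm', hmod⟩ := (H.exists_hasWalk_reattach h₀ hq hN hw).1 ht
      exact ⟨m', Or.inl ⟨hm', hmod⟩⟩
    · obtain ⟨m', hm', hmod⟩ := (H.exists_hasWalk_reattach h₀ hq hN hw).1 ht'
      exact ⟨m', Or.inr ⟨hm', by push_cast; rw [hmod]⟩⟩
  · exact hn.imp (fun h => ⟨(H.hasWalk_of_reattach h₀ hdom h.1).1 ht, h.2⟩)
      fun h => ⟨(H.hasWalk_of_reattach h₀ hdom h.1).1 ht', h.2⟩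

theorem isCycleSet_of_reattach [Finite V] [Finite E] (hd : ∀ e, ¬ (ends e).IsDiag) {C : Set E}
    (hC : IsCycleSet (reattach ends B x y) C) :
    IsCycleSet ends C ∧
      ((C ⊆ touching ends B ∧ ∀ v, OnEdgeSet (reattach ends B x y) C v →
          (v ∈ B ∧ OnEdgeSet ends C v) ∨ (v = y ∧ OnEdgeSet ends C x)) ∨
        ((∀ e ∈ C, e ∉ touching ends B) ∧ ∀ v, OnEdgeSet (reattach ends B x y) C v →
          v ∉ B ∧ OnEdgeSet ends C v)) := by
  classical
  have hcut : ∀ e ∈ touching ends B, ∀ f ∉ touching ends B, ∀ v, v ∈ reattach ends B x y e →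
      v ∈ reattach ends B x y f → v = y := by
    intro e he f hf v hve hvf
    rcases H.mem_reattach_of_mem_touching he hve with ⟨h, -⟩ | ⟨h, -⟩
    · exact absurd ⟨v, h, by rwa [reattach_of_notMem hf] at hvf⟩ hf
    · exact h
  rcases hC.subset_or_disjoint (H.not_isDiag hd) hcut with hM | hM
  · have hon : ∀ v, OnEdgeSet (reattach ends B x y) C v →
        (v ∈ B ∧ OnEdgeSet ends C v) ∨ (v = y ∧ OnEdgeSet ends C x) := by
      rintro v ⟨e, he, hv⟩
      exact (H.mem_reattach_of_mem_touching (hM he) hv).imp (fun h => ⟨h.1, e, he, h.2⟩)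
        fun h => ⟨h.1, e, he, h.2⟩
    refine ⟨(hC.map (φ := fun v => if v = y then x else v) (fun e he => ?_)
      fun a b ha hb hab => ?_).1, Or.inl ⟨hM, hon⟩⟩
    · have hB : ∀ v ∈ B, (if v = y then x else v) = v := fun v hv =>
        if_neg (by rintro rfl; exact H.right_notMem hv)
      obtain ⟨u, v, h⟩ : ∃ u v, reattach ends B x y e = s(u, v) :=
        Sym2.inductionOn (reattach ends B x y e) fun a b => ⟨a, b, rfl⟩
      rw [h, Sym2.map_mk]
      rcases H.reattach_cases h with ⟨-, -, -, h⟩ | ⟨h1, h2, h⟩ | ⟨rfl, h1, h⟩ | ⟨rfl, h1, h⟩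
      · exact absurd (hM he) h
      · rw [h, hB u h1, hB v h2]
      · rw [h, hB v h1, if_pos rfl]
      · rw [h, hB u h1, if_pos rfl]
    · have h1 := (hon a ha).imp And.left And.left
      have h2 := (hon b hb).imp And.left And.left
      have h3 := H.left_notMem
      grind
  · have he : ∀ e ∈ C, reattach ends B x y e = ends e := fun e he => reattach_of_notMem (hM e he)
    refine ⟨(hC.map (φ := id) (fun e h => ?_) fun a b _ _ h => h).1, Or.inr ⟨hM, ?_⟩⟩
    · rw [he e h, Sym2.map_id, id]
    · rintro v ⟨e, h, hv⟩
      rw [he e h] at hv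
      exact ⟨fun hB => hM e h ⟨v, hB, hv⟩, e, h, hv⟩

theorem isBead [Finite V] [Finite E] (hd : ∀ e, ¬ (ends e).IsDiag) (hb : IsBead ends)
    (hno : ∀ C₁ C₂, IsCycleSet ends C₁ → IsCycleSet ends C₂ → C₁ ⊆ touching ends B →
      OnEdgeSet ends C₁ x → (∀ e ∈ C₂, e ∉ touching ends B) → ¬ OnEdgeSet ends C₂ y) :
    IsBead (reattach ends B x y) := by
  rintro C₁ C₂ h₁ h₂ hne v ⟨hv₁, hv₂⟩
  obtain ⟨c₁, ⟨m₁, o₁⟩ | ⟨m₁, o₁⟩⟩ := H.isCycleSet_of_reattach hd h₁ <;>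
    obtain ⟨c₂, ⟨m₂, o₂⟩ | ⟨m₂, o₂⟩⟩ := H.isCycleSet_of_reattach hd h₂
  · rcases o₁ v hv₁ with ⟨hB, w₁⟩ | ⟨rfl, w₁⟩ <;> rcases o₂ v hv₂ with ⟨hB', w₂⟩ | ⟨h, w₂⟩
    · exact hb _ _ c₁ c₂ hne v ⟨w₁, w₂⟩
    · exact H.right_notMem (h ▸ hB)
    · exact H.right_notMem hB'
    · exact hb _ _ c₁ c₂ hne x ⟨w₁, w₂⟩
  · obtain ⟨hB, w₂⟩ := o₂ v hv₂
    rcases o₁ v hv₁ with ⟨hB', -⟩ | ⟨rfl, w₁⟩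
    · exact hB hB'
    · exact hno _ _ c₁ c₂ m₁ w₁ m₂ w₂
  · obtain ⟨hB, w₁⟩ := o₁ v hv₁
    rcases o₂ v hv₂ with ⟨hB', -⟩ | ⟨rfl, w₂⟩
    · exact hB hB'
    · exact hno _ _ c₂ c₁ m₂ w₂ m₁ w₁
  · exact hb _ _ c₁ c₂ hne v ⟨(o₁ v hv₁).2, (o₂ v hv₂).2⟩

end HangsAt

end Reattach

/-- The least number of edges of a walk from `v₀` to `v`. -/
noncomputable def stepDist {E V : Type} (ends : E → Sym2 V) (v₀ v : V) : ℕ :=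
  sInf {n | HasWalk ends (fun _ => 1) v₀ v n}

/-- A bead graph with initial vertex `v₀` of degree one in which a phase of `e` occurs only from
time `τ` on, and `e` lies on a path from `v₀` which meets cycles in its last vertex at most. -/
structure IsReducible {E V : Type} (ends : E → Sym2 V) (l : E → ℕ) (v₀ : V) (e : E) (τ : ℕ) :
    Prop where
  isDPSystem : IsDPSystem ends {v₀}
  isBead : IsBead ends
  hasLatePhase : HasLatePhase ends l v₀ e τ
  degree_eq : degree ends v₀ = 1
  exists_path : ∃ p d k, IsSimplePath ends p d k ∧ p 0 = v₀ ∧ (∃ i < k, d i = e) ∧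
    ∀ i < k, ∀ C, IsCycleSet ends C → ¬ OnEdgeSet ends C (p i)

section DegreeReduction

variable {E V : Type} {ends : E → Sym2 V} {l : E → ℕ} {v₀ : V} {e : E} {τ : ℕ}

theorem HasWalk.eq_of_one {a b : V} (h : HasWalk ends (fun _ => 1) a b 0) : a = b := by
  generalize hn : 0 = n at h
  cases h with
  | nil => rfl
  | snoc => omega

theorem IsBead.ncard_cycle_edges_le [Finite E] (hb : IsBead ends) (x : V) :
    {f | x ∈ ends f ∧ ∃ C, IsCycleSet ends C ∧ f ∈ C}.ncard ≤ 2 := by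
  by_cases hC : ∃ C, IsCycleSet ends C ∧ OnEdgeSet ends C x
  · obtain ⟨C, hC, hx⟩ := hC
    rw [← hC.2.2 x hx, edgeDegree]
    refine Set.ncard_le_ncard ?_ (Set.toFinite _)
    rintro f ⟨hf, C', hC', hfC'⟩
    by_cases h : C' = C
    · exact ⟨h ▸ hfC', hf⟩
    · exact absurd ⟨⟨f, hfC', hf⟩, hx⟩ (hb C' C hC' hC h x)
  · have : {f | x ∈ ends f ∧ ∃ C, IsCycleSet ends C ∧ f ∈ C} = ∅ := by
      ext f
      exact ⟨fun ⟨hf, C, h, hfC⟩ => hC ⟨C, h, f, hfC, hf⟩, False.elim⟩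
    rw [this, Set.ncard_empty]
    omega

theorem IsBead.exists_notMem_cycle_ne [Finite E] (hb : IsBead ends) {x : V}
    (hx : 4 ≤ degree ends x) (g : E) :
    ∃ f ≠ g, x ∈ ends f ∧ ∀ C, IsCycleSet ends C → f ∉ C := by
  have h1 := hb.ncard_cycle_edges_le x
  have h2 := Set.le_ncard_sdiff {f | x ∈ ends f ∧ ∃ C, IsCycleSet ends C ∧ f ∈ C}
    {f | x ∈ ends f} (Set.toFinite _)
  rw [degree] at hx
  obtain ⟨f, ⟨hf, hfC⟩, hfg⟩ := Set.exists_ne_of_one_lt_ncard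
    (s := {f | x ∈ ends f} \ {f | x ∈ ends f ∧ ∃ C, IsCycleSet ends C ∧ f ∈ C}) (by omega) g
  exact ⟨f, hfg, hf, fun C hC h => hfC ⟨hf, C, hC, h⟩⟩

theorem exists_mem_ends_ne_ne [Finite E] {x : V} (hx : 3 ≤ degree ends x) (g h : E) :
    ∃ f, f ≠ g ∧ f ≠ h ∧ x ∈ ends f := by
  by_contra hcon
  push Not at hcon
  have h1 : {f | x ∈ ends f} ⊆ {g, h} := fun f hf => by
    by_contra hno
    simp only [Set.mem_insert_iff, Set.mem_singleton_iff, not_or] at hno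
    exact hcon f hno.1 hno.2 hf
  have h2 := Set.ncard_le_ncard h1 (Set.toFinite _)
  have h3 := Set.ncard_insert_le g {h}
  rw [Set.ncard_singleton] at h3
  rw [degree] at hx
  omega

theorem IsSimplePath.reach_off_last {p : ℕ → V} {d : ℕ → E} {n : ℕ} (hp : IsSimplePath ends p d n)
    {j : ℕ} (hj : j < n) : Reach ends {e | p (j + 1) ∉ ends e} (p 0) (p j) :=
  hp.reach (Nat.zero_le _) hj.le fun i _ hi h => by
    have := (hp.mem_ends_iff (show j + 1 ≤ n by omega) (show i < n by omega)).1 h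
    omega

/-- At a vertex of degree at least four, choose the edge `g` leading back to `v₀`, a bridge `f₁`
whose far side can be moved, and an edge `f₂` along which to move it. -/
theorem exists_movable [Finite E] (hD : IsDPSystem ends {v₀}) (hb : IsBead ends)
    {p : ℕ → V} {d : ℕ → E} {k : ℕ} (hp : IsSimplePath ends p d k) (hp0 : p 0 = v₀)
    (hcyc : ∀ i < k, ∀ C, IsCycleSet ends C → ¬ OnEdgeSet ends C (p i))
    {x : V} (hx : 4 ≤ degree ends x) (hxv : x ≠ v₀) :
    ∃ g f₁ f₂ u, g ≠ f₁ ∧ g ≠ f₂ ∧ f₁ ≠ f₂ ∧ ends g = s(u, x) ∧ x ∈ ends f₁ ∧ x ∈ ends f₂ ∧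
      Reach ends {e | x ∉ ends e} v₀ u ∧ (∀ C, IsCycleSet ends C → f₁ ∉ C) ∧
      ((∀ C, IsCycleSet ends C → g ∉ C) ∨ ∀ C, IsCycleSet ends C → f₂ ∉ C) ∧
      ∀ i < k, d i ≠ f₁ := by
  have hx3 : 3 ≤ degree ends x := by omega
  by_cases hpx : ∃ j ≤ k, p j = x
  · obtain ⟨j, hj, rfl⟩ := hpx
    obtain ⟨j, rfl⟩ : ∃ i, j = i + 1 := ⟨j - 1, by
      have : j ≠ 0 := fun h => hxv (by rw [h, hp0])
      omega⟩
    have hg := hp.ends_eq j (by omega)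
    have hgC : ∀ C, IsCycleSet ends C → d j ∉ C := fun C hC h =>
      hcyc j (by omega) C hC ⟨d j, h, by simp [hg]⟩
    obtain ⟨f₁, h1, h2, h3, h4⟩ : ∃ f₁, f₁ ≠ d j ∧ p (j + 1) ∈ ends f₁ ∧
        (∀ C, IsCycleSet ends C → f₁ ∉ C) ∧ ∀ i < k, d i ≠ f₁ := by
      by_cases hjk : j + 1 < k
      · obtain ⟨f, h1, h2, h3⟩ := exists_mem_ends_ne_ne hx3 (d j) (d (j + 1))
        refine ⟨f, h1, h3, fun C hC h => hcyc _ hjk C hC ⟨f, h, h3⟩, fun i hi hif => ?_⟩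
        subst hif
        rcases (hp.mem_ends_iff hj hi).1 h3 with rfl | h
        · exact h2 rfl
        · exact h1 (by rw [show i = j by omega])
      · obtain ⟨f, h1, h2, h3⟩ := hb.exists_notMem_cycle_ne hx (d j)
        refine ⟨f, h1, h2, h3, fun i hi hif => ?_⟩
        subst hif
        rcases (hp.mem_ends_iff hj hi).1 h2 with h | h
        · omega
        · exact h1 (by rw [show i = j by omega])
    obtain ⟨f₂, h5, h6, h7⟩ := exists_mem_ends_ne_ne hx3 (d j) f₁
    exact ⟨d j, f₁, f₂, p j, h1.symm, h5.symm, h6.symm, hg, h2, h7,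
      hp0 ▸ hp.reach_off_last (by omega), h3, Or.inl hgC, h4⟩
  · have hoff : ∀ f, x ∈ ends f → ∀ i < k, d i ≠ f := by
      rintro f hf i hi rfl
      rw [hp.ends_eq i hi, Sym2.mem_iff] at hf
      rcases hf with rfl | rfl
      · exact hpx ⟨i, hi.le, rfl⟩
      · exact hpx ⟨i + 1, hi, rfl⟩
    obtain ⟨f, h1, h2, h3⟩ := exists_mem_ends_ne_ne hx3 (d 0) (d 0)
    have : Nonempty E := ⟨f⟩
    obtain ⟨m, hm⟩ := hD.exists_hasWalk (fun _ => 1) v₀ x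
    obtain ⟨P, D, n, hP, hP0, rfl, -⟩ := hm.reach.exists_isSimplePath hD.2.1
    obtain ⟨n, rfl⟩ : ∃ i, n = i + 1 := ⟨n - 1, by
      have : n ≠ 0 := fun h => hxv (by rw [h, hP0])
      omega⟩
    have hg := hP.ends_eq n (by omega)
    have hr := hP.reach_off_last (j := n) (by omega)
    rw [hP0] at hr
    by_cases hgC : ∀ C, IsCycleSet ends C → D n ∉ C
    · obtain ⟨f₁, h1, h2, h3⟩ := hb.exists_notMem_cycle_ne hx (D n)
      obtain ⟨f₂, h5, h6, h7⟩ := exists_mem_ends_ne_ne hx3 (D n) f₁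
      exact ⟨D n, f₁, f₂, P n, h1.symm, h5.symm, h6.symm, hg, h2, h7, hr, h3, Or.inl hgC,
        hoff f₁ h2⟩
    · obtain ⟨f₁, h1, h2, h3⟩ := hb.exists_notMem_cycle_ne hx (D n)
      obtain ⟨f₂, h5, h6, h7⟩ := hb.exists_notMem_cycle_ne hx f₁
      exact ⟨D n, f₁, f₂, P n, h1.symm, fun h => hgC (h ▸ h7), h5.symm, hg, h2, h6, hr, h3,
        Or.inr h7, hoff f₁ h2⟩

theorem IsReducible.exists_sum_lt [Fintype V] [Finite E] (hl : ∀ e, 0 < l e)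
    (h : IsReducible ends l v₀ e τ) {x : V} (hx : 4 ≤ degree ends x) :
    ∃ ends', IsReducible ends' l v₀ e τ ∧
      ∑ v, stepDist ends v₀ v < ∑ v, stepDist ends' v₀ v := by
  obtain ⟨p, d, k, hp, hp0, ⟨i₀, hi₀, rfl⟩, hcyc⟩ := h.exists_path
  have hd := h.isDPSystem.2.1
  have hxv : x ≠ v₀ := by
    rintro rfl
    rw [h.degree_eq] at hx
    omega
  obtain ⟨g, f₁, f₂, u, hgf₁, hgf₂, hf₁₂, hg, hf₁, hf₂, hr, hc₁, hc₂, hoff⟩ :=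
    exists_movable h.isDPSystem h.isBead hp hp0 hcyc hx hxv
  obtain ⟨z, hz⟩ := Sym2.mem_iff_exists.1 hf₁
  obtain ⟨y, hy⟩ := Sym2.mem_iff_exists.1 hf₂
  let B : Set V := {v | ¬ Reach ends {e | e ≠ f₁} x v}
  have hB : ∀ v, Reach ends {e | e ≠ f₁} x v → v ∉ B := fun v hv hvB => hvB hv
  have hxB : x ∉ B := hB x .refl
  have hyB : y ∉ B := hB y (Reach.single (F := {e | e ≠ f₁}) hf₁₂.symm hy)
  have hvB : Reach ends {e | e ≠ f₁} x v₀ :=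
    (Reach.single hgf₁ (hg.trans Sym2.eq_swap)).trans
      (hr.mono fun f hf => by rintro rfl; exact hf hf₁).symm
  have hpB : ∀ i ≤ k, p i ∉ B := fun i hi => hB _ <| hvB.trans <| hp0 ▸
    hp.reach (Nat.zero_le i) hi fun j _ hj => hoff j (by omega)
  have hzB : z ∈ B := not_reach_of_forall_notMem_cycle hd hc₁ hz
  have hne : x ≠ y := fun hxy => hd f₂ (by rw [hy]; exact hxy)
  have H : HangsAt ends B x y := by
    refine ⟨hxB, hyB, fun e a b he ha => ?_⟩
    by_contra! hcon
    have hbB : Reach ends {e | e ≠ f₁} x b := not_not.1 hcon.1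
    by_cases hef : e = f₁
    · rw [hef, hz, Sym2.eq_iff] at he
      rcases he with ⟨rfl, rfl⟩ | ⟨rfl, rfl⟩
      · exact hxB ha
      · exact hcon.2 rfl
    · exact ha (hbB.trans (Reach.single (F := {e | e ≠ f₁}) hef (he.trans Sym2.eq_swap)))
  have hM : ∀ f ∈ touching ends B, x ∈ ends f → f = f₁ := by
    rintro f ⟨b, hb, hbf⟩ hxf
    by_contra hff
    have hxb : x ≠ b := fun h => hxB (h ▸ hb)
    exact hb (Reach.single (F := {e | e ≠ f₁}) hff ((Sym2.mem_and_mem_iff hxb).1 ⟨hxf, hbf⟩))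
  have hpM : ∀ i < k, d i ∉ touching ends B := fun i hi =>
    notMem_touching (hp.ends_eq i hi) (hpB i hi.le) (hpB (i + 1) hi)
  have hvy : ¬ Reach ends {e | x ∉ ends e} v₀ y := by
    intro hv
    have huy : Reach ends {e | x ∉ ends e} u y := hr.symm.trans hv
    rcases hc₂ with hc | hc
    · refine not_reach_of_forall_notMem_cycle hd hc hg ?_
      have hxg : x ∈ ends g := by simp [hg]
      exact (huy.mono fun f hf => by rintro rfl; exact hf hxg).trans
        (Reach.single (F := {e | e ≠ g}) hgf₂.symm (hy.trans Sym2.eq_swap))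
    · refine not_reach_of_forall_notMem_cycle hd hc hy ?_
      exact (Reach.single (F := {e | e ≠ f₂}) hgf₂ (hg.trans Sym2.eq_swap)).trans
        (huy.mono fun f hf => by rintro rfl; exact hf hf₂)
  have hdom : ∀ (l : E → ℕ) n, HasWalk ends l v₀ y n →
      ∃ k₁ k₂, HasWalk ends l v₀ x k₁ ∧ HasWalk ends l x y k₂ ∧ k₁ + k₂ = n :=
    fun l n hn => (hn.split_or_reach x).resolve_right hvy
  have hq : ∀ l : E → ℕ, HasWalk (reattach ends B x y) l x y (l f₂) := fun l =>
    .single f₂ ((reattach_of_notMem (notMem_touching hy hxB hyB)).trans hy)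
  have hv₀ : v₀ ∉ B := hB _ hvB
  have hDP := H.isDPSystem h.isDPSystem hv₀ (hq l)
  have hno : ∀ C, IsCycleSet ends C → C ⊆ touching ends B → ¬ OnEdgeSet ends C x := by
    intro C hC hCM hon
    obtain ⟨a, b, hab, ha, hb, hxa, hxb, -⟩ := hC.exists_pair hon
    exact hab ((hM a (hCM ha) hxa).trans (hM b (hCM hb) hxb).symm)
  refine ⟨reattach ends B x y, ⟨hDP, ?_, ?_, ?_, ?_⟩, ?_⟩
  · exact H.isBead hd h.isBead fun C₁ C₂ h₁ _ h₃ h₄ => absurd h₄ (hno C₁ h₁ h₃)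
  · exact H.hasLatePhase hv₀ hl (hq l) (hdom l) (hpM i₀ hi₀) h.hasLatePhase
  · rw [← h.degree_eq, degree, degree]
    congr 1
    ext f
    exact mem_reattach_iff hxv.symm fun hy => hvy (hy ▸ .refl)
  · refine ⟨p, d, k, hp.congr_ends fun i hi => reattach_of_notMem (hpM i hi), hp0, ⟨i₀, hi₀, rfl⟩,
      fun i hi C hC hon => ?_⟩
    obtain ⟨hC', ⟨hCM, hv⟩ | ⟨-, hv⟩⟩ := H.isCycleSet_of_reattach hd hC
    · rcases hv _ hon with ⟨-, h⟩ | ⟨-, h⟩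
      · exact hcyc i hi C hC' h
      · exact hno C hC' hCM h
    · exact hcyc i hi C hC' (hv _ hon).2
  · have key : ∀ v, stepDist ends v₀ v ≤ stepDist (reattach ends B x y) v₀ v ∧
        (v ∈ B → stepDist ends v₀ v < stepDist (reattach ends B x y) v₀ v) := by
      intro v
      have hmem : HasWalk (reattach ends B x y) (fun _ => 1) v₀ v
          (stepDist (reattach ends B x y) v₀ v) :=
        Nat.sInf_mem (s := {n | HasWalk (reattach ends B x y) (fun _ => 1) v₀ v n})
          (hDP.exists_hasWalk _ v₀ v)
      have hlt : v ∈ B → stepDist ends v₀ v < stepDist (reattach ends B x y) v₀ v := by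
        intro hvB
        obtain ⟨k₁, k₂, k₃, h₁, h₂, h₃, hk⟩ := (H.hasWalk_of_reattach hv₀ (hdom _) hmem).2 hvB
        have h4 : stepDist ends v₀ v ≤ k₁ + k₃ := Nat.sInf_le (h₁.trans h₃)
        have h5 : k₂ ≠ 0 := by
          rintro rfl
          exact hne h₂.eq_of_one
        omega
      by_cases hvB : v ∈ B
      · exact ⟨(hlt hvB).le, hlt⟩
      · exact ⟨Nat.sInf_le ((H.hasWalk_of_reattach hv₀ (hdom _) hmem).1 hvB), hlt⟩
    exact Finset.sum_lt_sum (fun v _ => (key v).1) ⟨z, Finset.mem_univ _, (key z).2 hzB⟩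

theorem IsReducible.exists_degree_le_three [Finite E] (hl : ∀ e, 0 < l e)
    (h : IsReducible ends l v₀ e τ) :
    ∃ ends' : E → Sym2 V, IsReducible ends' l v₀ e τ ∧ ∀ x, degree ends' x ≤ 3 := by
  classical
  have := h.isDPSystem.1
  have := Fintype.ofFinite V
  have : Finite (Sym2 V) := Quot.finite _
  obtain ⟨ends', h', hmax⟩ := Set.exists_max_image {ends' : E → Sym2 V | IsReducible ends' l v₀ e τ}
    (fun ends' => ∑ v, stepDist ends' v₀ v) (Set.toFinite _) ⟨ends, h⟩
  refine ⟨ends', h', fun x => ?_⟩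
  by_contra! hx
  obtain ⟨ends'', h'', hlt⟩ := IsReducible.exists_sum_lt hl h' hx
  exact absurd (hmax ends'' h'') (not_le.2 hlt)

end DegreeReduction

/-- A path whose inner vertices have degree two in the whole graph. -/
structure IsHandle {E V : Type} (ends : E → Sym2 V) (p : ℕ → V) (d : ℕ → E) (m : ℕ) : Prop where
  isSimplePath : IsSimplePath ends p d m
  pos : 0 < m
  inner : ∀ i, i + 1 < m → ∀ e, p (i + 1) ∈ ends e → e = d i ∨ e = d (i + 1)

section Handle

variable {E V : Type} {ends : E → Sym2 V} {l : E → ℕ} {v₀ : V} {τ : ℕ}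
  {p : ℕ → V} {d : ℕ → E} {m : ℕ}

theorem eq_or_eq_of_degree_le_two [Finite E] {x : V} (hx : degree ends x ≤ 2) {e f g : E}
    (hef : e ≠ f) (he : x ∈ ends e) (hf : x ∈ ends f) (hg : x ∈ ends g) : g = e ∨ g = f := by
  have h1 : ({e, f} : Set E) ⊆ {e | x ∈ ends e} := by
    rintro _ (rfl | rfl) <;> assumption
  have h2 := Set.eq_of_subset_of_ncard_le h1 (by rw [Set.ncard_pair hef]; exact hx) (Set.toFinite _)
  have h3 : g ∈ {e | x ∈ ends e} := hg
  rwa [← h2] at h3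

theorem exists_isHandle [Finite E] (hd : ∀ e, ¬ (ends e).IsDiag) {H : Set E}
    (hH : IsPathSet ends H)
    (hterm : ∃ x : V, IsHandleTerminal ends H x ∧
      ∀ y : V, OnEdgeSet ends H y → y ≠ x → degree ends y ≤ 2)
    (hv₀ : IsHandleTerminal ends H v₀) {e : E} (he : e ∈ H) :
    ∃ p d m, IsHandle ends p d (m + 1) ∧ p 0 = v₀ ∧ d m = e ∧
      (degree ends (p 0) ≤ 2 ∨ degree ends (p (m + 1)) ≤ 2) := by
  classical
  have : Nonempty E := ⟨e⟩
  obtain ⟨x, hx, hdeg⟩ := hterm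
  have hon : OnEdgeSet ends H v₀ := by
    obtain ⟨f, hf⟩ := Set.ncard_eq_one.1 hv₀
    have : f ∈ {e ∈ H | v₀ ∈ ends e} := by rw [hf]; exact rfl
    exact ⟨f, this.1, this.2⟩
  obtain ⟨a, b, hab, -⟩ := exists_ends_eq hd e
  obtain ⟨p, d, n, hp, rfl, rfl, hF⟩ := (edgeSetConn_iff.1 hH.2.1 v₀ a hon
    ⟨e, he, by simp [hab]⟩).exists_isSimplePath hd
  have hex : ∃ i, i ≤ n ∧ p i ∈ ends e := ⟨n, le_rfl, by simp [hab]⟩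
  obtain ⟨hi, hie⟩ := Nat.find_spec hex
  have hmin : ∀ j < Nat.find hex, p j ∉ ends e := fun j hj h =>
    Nat.find_min hex hj ⟨by omega, h⟩
  generalize Nat.find hex = i at hi hie hmin
  obtain ⟨c, hc⟩ := Sym2.mem_iff_exists.1 hie
  obtain ⟨p', d', hp', hpp, -, hdd, hde⟩ := (hp.take hi).exists_concat hc fun j hj hjc => by
    rcases hj.lt_or_eq with h | rfl
    · exact hmin j h (by rw [hc, hjc]; simp)
    · exact hd e (by rw [hc, hjc]; exact rfl)
  have hdH : ∀ j < i + 1, d' j ∈ H := by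
    intro j hj
    rcases (Nat.lt_succ_iff.1 hj).lt_or_eq with h | rfl
    · rw [hdd j h]
      exact hF j (by omega)
    · rwa [hde]
  have honp : ∀ j ≤ i + 1, OnEdgeSet ends H (p' j) := by
    intro j hj
    rcases hj.lt_or_eq with h | rfl
    · exact ⟨d' j, hdH j h, by simp [hp'.ends_eq j h]⟩
    · exact ⟨d' i, hdH i (by omega), by simp [hp'.ends_eq i (by omega)]⟩
  refine ⟨p', d', i, ⟨hp', i.succ_pos, fun j hj g hg => ?_⟩, hpp 0 (Nat.zero_le _), hde, ?_⟩
  · have h1 : p' (j + 1) ∈ ends (d' j) := by simp [hp'.ends_eq j (by omega)]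
    have h2 : p' (j + 1) ∈ ends (d' (j + 1)) := by simp [hp'.ends_eq (j + 1) (by omega)]
    have hne : d' j ≠ d' (j + 1) := fun h => by
      have := hp'.edge_inj (by omega) (by omega) h
      omega
    refine eq_or_eq_of_degree_le_two (hdeg _ (honp _ (by omega)) fun hxx => ?_) hne h1 h2 hg
    obtain ⟨f, hf⟩ := Set.ncard_eq_one.1 hx
    have h3 : d' j ∈ {e ∈ H | x ∈ ends e} := ⟨hdH j (by omega), hxx ▸ h1⟩
    have h4 : d' (j + 1) ∈ {e ∈ H | x ∈ ends e} := ⟨hdH _ (by omega), hxx ▸ h2⟩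
    rw [hf] at h3 h4
    exact hne (h3.trans h4.symm)
  · by_cases h : p' 0 = x
    · refine Or.inr (hdeg _ (honp _ le_rfl) fun h' => ?_)
      have := hp'.inj _ (Nat.zero_le _) _ le_rfl (h.trans h'.symm)
      omega
    · exact Or.inl (hdeg _ (honp _ (Nat.zero_le _)) h)

namespace IsHandle

variable (h : IsHandle ends p d m)
include h

theorem mem_and_mem {C : Set E} (hC : IsCycleSet ends C) {i : ℕ} (hi : i + 1 < m)
    (hon : OnEdgeSet ends C (p (i + 1))) : d i ∈ C ∧ d (i + 1) ∈ C := by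
  obtain ⟨e, f, hef, he, hf, hpe, hpf, -⟩ := hC.exists_pair hon
  rcases h.inner i hi e hpe with rfl | rfl <;> rcases h.inner i hi f hpf with rfl | rfl
  · exact absurd rfl hef
  · exact ⟨he, hf⟩
  · exact ⟨hf, he⟩
  · exact absurd rfl hef

theorem mem_iff {C : Set E} (hC : IsCycleSet ends C) {i : ℕ} (hi : i < m) :
    d i ∈ C ↔ d 0 ∈ C := by
  induction i with
  | zero => rfl
  | succ i ih =>
    rw [← ih (by omega)]
    exact ⟨fun hd => (h.mem_and_mem hC hi
        ⟨_, hd, by simp [h.isSimplePath.ends_eq (i + 1) hi]⟩).1,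
      fun hd => (h.mem_and_mem hC hi
        ⟨_, hd, by simp [h.isSimplePath.ends_eq i (by omega)]⟩).2⟩

theorem onEdgeSet_zero {C : Set E} (hC : IsCycleSet ends C) {i : ℕ} (hi : i < m)
    (hon : OnEdgeSet ends C (p i)) : OnEdgeSet ends C (p 0) := by
  cases i with
  | zero => exact hon
  | succ i =>
    exact ⟨d 0, (h.mem_iff hC (by omega)).1 (h.mem_and_mem hC hi hon).1,
      by simp [h.isSimplePath.ends_eq 0 h.pos]⟩

theorem zero_notMem_ends {i : ℕ} (hi : i < m) (h0 : 0 < i) : p 0 ∉ ends (d i) := fun hm => by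
  have := (h.isSimplePath.mem_ends_iff (Nat.zero_le _) hi).1 hm
  omega

theorem reach_off_zero {i : ℕ} (hi : i ≤ m) (h0 : 0 < i) :
    Reach ends {e | p 0 ∉ ends e} (p m) (p i) :=
  (h.isSimplePath.reach hi le_rfl fun j hij hj => h.zero_notMem_ends hj (by omega)).symm

/-- Everything hanging at the start of the handle can be moved to its other end. -/
theorem exists_reattach [Finite E] (hl : ∀ e, 0 < l e) (hD : IsDPSystem ends {p 0})
    (hb : IsBead ends) {e : E} {i₀ : ℕ} (hi₀ : i₀ < m) (he : d i₀ = e)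
    (hlate : HasLatePhase ends l (p 0) e τ)
    (hdeg : degree ends (p 0) ≤ 2 ∨ degree ends (p m) ≤ 2) :
    ∃ ends' : E → Sym2 V, IsDPSystem ends' {p 0} ∧ IsBead ends' ∧
      HasLatePhase ends' l (p 0) e τ ∧ IsHandle ends' p d m ∧
      ∀ f a, ends' f = s(p 0, a) → Reach ends' {g | p 0 ∉ ends' g} (p m) a := by
  have hd := hD.2.1
  have := hD.1
  have hp := h.isSimplePath
  have hne : p 0 ≠ p m := fun h0 => by
    have := hp.inj _ (Nat.zero_le _) _ le_rfl h0
    have := h.pos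
    omega
  let B : Set V := {v | v ≠ p 0 ∧ ¬ Reach ends {e | p 0 ∉ ends e} (p m) v}
  have h0B : p 0 ∉ B := fun h => h.1 rfl
  have hrB : ∀ v, Reach ends {e | p 0 ∉ ends e} (p m) v → v ∉ B := fun v hv hvB => hvB.2 hv
  have H : HangsAt ends B (p 0) (p m) := by
    refine ⟨h0B, hrB _ .refl, fun e a b he ha => ?_⟩
    by_contra! hcon
    have hb : Reach ends {e | p 0 ∉ ends e} (p m) b := by
      by_contra hb
      exact hcon.1 ⟨hcon.2, hb⟩
    refine ha.2 (hb.trans (Reach.single (e := e) ?_ (he.trans Sym2.eq_swap)))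
    change p 0 ∉ ends e
    rw [he, Sym2.mem_iff, not_or]
    exact ⟨ha.1.symm, hcon.2.symm⟩
  have hpB : ∀ i ≤ m, p i ∉ B := by
    intro i hi
    rcases Nat.eq_zero_or_pos i with rfl | h0
    · exact h0B
    · exact hrB _ (h.reach_off_zero hi h0)
  have hpM : ∀ i < m, d i ∉ touching ends B := fun i hi =>
    notMem_touching (hp.ends_eq i hi) (hpB i hi.le) (hpB (i + 1) hi)
  have hp' : IsSimplePath (reattach ends B (p 0) (p m)) p d m :=
    hp.congr_ends fun i hi => reattach_of_notMem (hpM i hi)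
  obtain ⟨c, hq⟩ := (hp'.reach (F := Set.univ) (Nat.zero_le m) le_rfl
    fun _ _ _ => trivial).exists_hasWalk l
  have h0d : p 0 ∈ ends (d 0) := by simp [hp.ends_eq 0 h.pos]
  refine ⟨reattach ends B (p 0) (p m), H.isDPSystem hD h0B hq,
    H.isBead hd hb fun C₁ C₂ h₁ h₂ hM₁ hon₁ hM₂ hon₂ => ?_,
    H.hasLatePhase h0B hl hq (fun n hn => ⟨0, n, .nil, hn, Nat.zero_add n⟩) (he ▸ hpM i₀ hi₀) hlate,
    ⟨hp', h.pos, fun i hi f hf => ?_⟩, fun f a hf => ?_⟩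
  · have hmd : p m ∈ ends (d (m - 1)) := by
      have := h.pos
      exact (hp.mem_ends_iff le_rfl (by omega)).2 (by omega)
    rcases hdeg with hdeg | hdeg
    · obtain ⟨g₁, g₂, hg, hg₁, hg₂, hpg₁, hpg₂, -⟩ := h₁.exists_pair hon₁
      rcases eq_or_eq_of_degree_le_two hdeg hg hpg₁ hpg₂ h0d with h0 | h0
      · exact hpM 0 h.pos (h0 ▸ hM₁ hg₁)
      · exact hpM 0 h.pos (h0 ▸ hM₁ hg₂)
    · have hmC : d (m - 1) ∈ C₂ := by
        obtain ⟨g₁, g₂, hg, hg₁, hg₂, hpg₁, hpg₂, -⟩ := h₂.exists_pair hon₂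
        rcases eq_or_eq_of_degree_le_two hdeg hg hpg₁ hpg₂ hmd with h0 | h0
        · rwa [h0]
        · rwa [h0]
      have h0C := (h.mem_iff h₂ (by have := h.pos; omega)).1 hmC
      refine hb C₁ C₂ h₁ h₂ ?_ (p 0) ⟨hon₁, d 0, h0C, h0d⟩
      rintro rfl
      exact hM₂ _ h0C (hM₁ h0C)
  · refine h.inner i hi f ((mem_reattach_iff (fun h0 => ?_) fun h0 => ?_).1 hf)
    · have := hp.inj _ (by omega) _ (by omega) h0
      omega
    · have := hp.inj _ (by omega) _ (by omega) h0
      omega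
  · rcases H.reattach_cases hf with ⟨-, ha, hfa, -⟩ | ⟨h1, -⟩ | ⟨h1, -⟩ | ⟨-, h1, -⟩
    · have hr : Reach ends {e | p 0 ∉ ends e} (p m) a := by
        by_contra hr
        exact ha ⟨fun h0 => hd f (by rw [hfa, h0]; exact rfl), hr⟩
      clear hf hfa ha
      induction hr with
      | refl => exact .refl
      | @tail b c hb hbc ih =>
        obtain ⟨g, hg, hgbc⟩ := hbc
        have hgr : reattach ends B (p 0) (p m) g = ends g := reattach_of_notMem
          (notMem_touching hgbc (hrB b hb) (hrB c (hb.tail ⟨g, hg, hgbc⟩)))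
        refine ih.tail ⟨g, ?_, hgr.trans hgbc⟩
        change p 0 ∉ reattach ends B (p 0) (p m) g
        rwa [hgr]
    · exact absurd h1 h0B
    · exact absurd h1 hne
    · exact absurd h1 h0B

theorem isReducible_of_degree_eq_one (hD : IsDPSystem ends {p 0}) (hb : IsBead ends) {e : E}
    {i₀ : ℕ} (hi₀ : i₀ < m) (he : d i₀ = e) (hlate : HasLatePhase ends l (p 0) e τ)
    (hdeg : degree ends (p 0) = 1) : IsReducible ends l (p 0) e τ := by
  refine ⟨hD, hb, hlate, hdeg, p, d, m, h.isSimplePath, rfl, ⟨i₀, hi₀, he⟩, fun i hi C hC hon => ?_⟩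
  obtain ⟨f, g, hfg, -, -, hf, hg, -⟩ := hC.exists_pair (h.onEdgeSet_zero hC hi hon)
  obtain ⟨k, hk⟩ := Set.ncard_eq_one.1 hdeg
  have h1 : f ∈ {e | p 0 ∈ ends e} := hf
  have h2 : g ∈ {e | p 0 ∈ ends e} := hg
  rw [hk] at h1 h2
  exact hfg (h1.trans h2.symm)

end IsHandle

end Handle

open Classical in
/-- The multigraph obtained by detaching the edge `c` from its endpoint other than `u`, leaving it
with a new endpoint `none`. -/
noncomputable def splitAt {E V : Type} (ends : E → Sym2 V) (c : E) (u : V) (e : E) :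
    Sym2 (Option V) :=
  if e = c then s(none, some u) else (ends e).map some

section Split

variable {E V : Type} {ends : E → Sym2 V} {l : E → ℕ} {v₀ : V} {τ : ℕ} {c : E} {u : V}

theorem splitAt_self : splitAt ends c u c = s(none, some u) := if_pos rfl

theorem splitAt_of_ne {e : E} (he : e ≠ c) : splitAt ends c u e = (ends e).map some := if_neg he

theorem none_mem_splitAt_iff {e : E} : none ∈ splitAt ends c u e ↔ e = c := by
  by_cases he : e = c
  · simp [he, splitAt_self]
  · simp [he, splitAt_of_ne]

theorem some_mem_splitAt_iff {e : E} {v : V} (hv : v ≠ u) :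
    some v ∈ splitAt ends c u e ↔ e ≠ c ∧ v ∈ ends e := by
  by_cases he : e = c
  · simp [he, splitAt_self, hv]
  · simp [he, splitAt_of_ne]

theorem eq_map_splitAt (hc : ends c = s(v₀, u)) (e : E) :
    ends e = (splitAt ends c u e).map fun o => o.getD v₀ := by
  by_cases he : e = c
  · rw [he, splitAt_self, Sym2.map_mk, hc]
    rfl
  · rw [splitAt_of_ne he, Sym2.map_map]
    exact (congrFun Sym2.map_id _).symm

theorem exists_splitAt_eq (hc : ends c = s(v₀, u)) {e : E} {a b : V} (he : ends e = s(a, b)) :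
    ∃ a' b', splitAt ends c u e = s(a', b') ∧ a'.getD v₀ = a ∧ b'.getD v₀ = b := by
  obtain ⟨a', b', h⟩ : ∃ a' b', splitAt ends c u e = s(a', b') :=
    Sym2.inductionOn (splitAt ends c u e) fun a b => ⟨a, b, rfl⟩
  have := eq_map_splitAt hc e
  rw [he, h, Sym2.map_mk, Sym2.eq_iff] at this
  rcases this with ⟨h1, h2⟩ | ⟨h1, h2⟩
  · exact ⟨a', b', h, h1.symm, h2.symm⟩
  · exact ⟨b', a', h.trans Sym2.eq_swap, h1.symm, h2.symm⟩

/-- Every walk from `v₀` lifts, up to a length multiple of `N`, to a walk from one of the two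
copies of `v₀`. -/
theorem HasWalk.exists_splitAt (hc : ends c = s(v₀, u)) {k : ℕ}
    (hk : HasWalk (splitAt ends c u) l (some v₀) none k) {N : ℕ} (hN : 0 < N) {v : V} {n : ℕ}
    (h : HasWalk ends l v₀ v n) (v' : Option V) (hv' : v'.getD v₀ = v) :
    ∃ s : Option V, s.getD v₀ = v₀ ∧ ∃ n', HasWalk (splitAt ends c u) l s v' n' ∧
      (n' : ZMod N) = n := by
  induction h generalizing v' with
  | nil => exact ⟨v', hv', 0, .nil, rfl⟩
  | @snoc a b n e _ he ih =>
    obtain ⟨a', b', he', ha', hb'⟩ := exists_splitAt_eq hc he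
    obtain ⟨s, hs, n', hn', hmod⟩ := ih a' ha'
    have hw := hn'.snoc e he'
    by_cases hvb : v' = b'
    · exact ⟨s, hs, _, hvb ▸ hw, by push_cast; rw [hmod]⟩
    have hcases : ∀ o : Option V, o.getD v₀ = v₀ → o = none ∨ o = some v₀ := by
      rintro (_ | o) ho
      · exact Or.inl rfl
      · exact Or.inr (congrArg some ho)
    have hb₀ : b = v₀ := by
      rcases v' with _ | v' <;> rcases b' with _ | b'
      · exact absurd rfl hvb
      · exact hv'.symm
      · exact hb'.symm
      · exact absurd (congrArg some (hv'.trans hb'.symm)) hvb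
    rw [hb₀] at hb' hv'
    have hk' : HasWalk (splitAt ends c u) l b' v' k := by
      rcases hcases _ hb' with rfl | rfl <;> rcases hcases _ hv' with rfl | rfl
      · exact absurd rfl hvb
      · exact hk.symm
      · exact hk
      · exact absurd rfl hvb
    by_cases hsb : s = b'
    · subst hsb
      refine ⟨v', hv', _, ((hk'.symm.trans hw).trans hk').trans
        ((hk'.symm.trans hk').repeat_closed (N - 1)), ?_⟩
      obtain ⟨M, rfl⟩ : ∃ M, N = M + 1 := ⟨N - 1, by omega⟩
      have : ((M + 1 : ℕ) : ZMod (M + 1)) = 0 := ZMod.natCast_self _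
      push_cast at this
      push_cast [Nat.add_sub_cancel]
      rw [hmod]
      linear_combination 2 * (k : ZMod (M + 1)) * this
    · have hsv : s = v' := by
        rcases hcases _ hs with rfl | rfl <;> rcases hcases _ hb' with rfl | rfl <;>
          rcases hcases _ hv' with rfl | rfl <;> first | rfl | exact absurd rfl ‹_›
      exact ⟨b', hb', _, (hsv ▸ hw).symm, by push_cast; rw [hmod]⟩

theorem splitAt_not_isDiag (hd : ∀ e, ¬ (ends e).IsDiag) (hc : ends c = s(v₀, u)) (e : E) :
    ¬ (splitAt ends c u e).IsDiag := by
  intro h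
  refine hd e ?_
  rw [eq_map_splitAt hc e]
  exact h.map

theorem isDPSystem_splitAt (hD : IsDPSystem ends {v₀}) (hc : ends c = s(v₀, u)) {k : ℕ}
    (hk : HasWalk (splitAt ends c u) l (some v₀) none k) (s : Option V) :
    IsDPSystem (splitAt ends c u) {s} := by
  have := hD.1
  have hcon : ∀ o, ∃ n, HasWalk (splitAt ends c u) l (some v₀) o n := by
    intro o
    obtain ⟨n, hn⟩ := hD.exists_hasWalk l v₀ (o.getD v₀)
    obtain ⟨s, hs, n', hn', -⟩ := HasWalk.exists_splitAt hc hk one_pos hn o rfl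
    rcases s with _ | s
    · exact ⟨_, hk.trans hn'⟩
    · exact ⟨n', (congrArg some hs : some s = some v₀) ▸ hn'⟩
  refine isDPSystem_of_hasWalk (l := l) (splitAt_not_isDiag hD.2.1 hc) fun o => ?_
  obtain ⟨n, hn⟩ := hcon o
  obtain ⟨n', hn'⟩ := hcon s
  exact ⟨_, hn'.symm.trans hn⟩

theorem HasLatePhase.exists_splitAt (hl : ∀ e, 0 < l e) (hc : ends c = s(v₀, u)) {k : ℕ}
    (hk : HasWalk (splitAt ends c u) l (some v₀) none k) {e : E}
    (h : HasLatePhase ends l v₀ e τ) :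
    ∃ s : Option V, s.getD v₀ = v₀ ∧ HasLatePhase (splitAt ends c u) l s e τ := by
  obtain ⟨t, t', he, r, ⟨n, hn⟩, hr⟩ := h
  obtain ⟨y, y', he', rfl, rfl⟩ := exists_splitAt_eq hc he
  have hlow : ∀ s : Option V, s.getD v₀ = v₀ →
      ∀ n, Arrives (splitAt ends c u) l s e y y' n r → τ ≤ n := by
    intro s hs n hn
    have hmap : ∀ o, HasWalk (splitAt ends c u) l s o n → HasWalk ends l v₀ (o.getD v₀) n := by
      intro o h
      have h' : HasWalk ends l (s.getD v₀) (o.getD v₀) n := h.map (eq_map_splitAt hc)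
      rwa [hs] at h'
    exact hr n (hn.imp (fun h => ⟨hmap _ h.1, h.2⟩) fun h => ⟨hmap _ h.1, h.2⟩)
  have hN : 0 < 2 * l e := by have := hl e; omega
  rcases hn with ⟨hw, rfl⟩ | ⟨hw, rfl⟩
  · obtain ⟨s, hs, n', hn', hmod⟩ := HasWalk.exists_splitAt hc hk hN hw y rfl
    exact ⟨s, hs, y, y', he', _, ⟨n', Or.inl ⟨hn', hmod⟩⟩, hlow s hs⟩
  · obtain ⟨s, hs, n', hn', hmod⟩ := HasWalk.exists_splitAt hc hk hN hw y' rfl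
    exact ⟨s, hs, y, y', he', _, ⟨n', Or.inr ⟨hn', by push_cast; rw [hmod]⟩⟩, hlow s hs⟩

theorem IsCycleSet.of_splitAt (hc : ends c = s(v₀, u)) {C : Set E}
    (hC : IsCycleSet (splitAt ends c u) C) :
    c ∉ C ∧ IsCycleSet ends C ∧
      ∀ o, OnEdgeSet (splitAt ends c u) C o → ∃ v, o = some v ∧ OnEdgeSet ends C v := by
  have hcC : c ∉ C := by
    intro h
    obtain ⟨e, f, hef, -, -, he, hf, -⟩ := hC.exists_pair (x := none) ⟨c, h, by simp [splitAt_self]⟩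
    rw [none_mem_splitAt_iff] at he hf
    exact hef (he.trans hf.symm)
  have hon : ∀ o, OnEdgeSet (splitAt ends c u) C o → ∃ v, o = some v ∧ OnEdgeSet ends C v := by
    rintro o ⟨e, he, ho⟩
    rw [splitAt_of_ne fun h : e = c => hcC (h ▸ he), Sym2.mem_map] at ho
    obtain ⟨v, hv, rfl⟩ := ho
    exact ⟨v, rfl, e, he, hv⟩
  refine ⟨hcC, (hC.map (fun e _ => eq_map_splitAt hc e) fun a b ha hb hab => ?_).1, hon⟩
  obtain ⟨v, rfl, -⟩ := hon a ha
  obtain ⟨w, rfl, -⟩ := hon b hb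
  exact congrArg some hab

/-- Opening a cycle at a vertex of degree two gives a reducible system. -/
theorem exists_isReducible_splitAt [Finite E] (hl : ∀ e, 0 < l e) (hD : IsDPSystem ends {v₀})
    (hb : IsBead ends) {e : E} (hlate : HasLatePhase ends l v₀ e τ) {P : ℕ → V} {D : ℕ → E} {n : ℕ}
    (hP : IsSimplePath ends P D n) (hP0 : P 0 = v₀) (hn : 0 < n) (hDc : ∀ i < n, D i ≠ c)
    (hc : ends c = s(v₀, P n)) (he : e = c ∨ ∃ i < n, D i = e)
    (hdeg : ∀ f, v₀ ∈ ends f → f = c ∨ f = D 0) :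
    ∃ s, IsReducible (splitAt ends c (P n)) l s e τ := by
  have hX₀ : IsSimplePath (splitAt ends c (P n)) (fun i => some (P i)) D n :=
    ⟨fun i hi => by rw [splitAt_of_ne (hDc i hi), hP.ends_eq i hi, Sym2.map_mk],
      fun i hi j hj hij => hP.inj i hi j hj (Option.some_injective _ hij)⟩
  obtain ⟨X, Y, hX, hXP, hXn, hYD, hYn⟩ := hX₀.exists_concat (v := none) (e := c)
    (splitAt_self.trans Sym2.eq_swap) fun i _ => Option.some_ne_none _
  have hX0 : X 0 = some v₀ := by rw [hXP 0 (Nat.zero_le n), hP0]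
  have hreach := hX.reach (F := Set.univ) (Nat.zero_le _) le_rfl fun _ _ _ => trivial
  rw [hX0, hXn] at hreach
  obtain ⟨k, hk⟩ := hreach.exists_hasWalk l
  obtain ⟨s, hs, hlate'⟩ := hlate.exists_splitAt hl hc hk
  have hvn : v₀ ≠ P n := fun h => hD.2.1 c (by rw [hc]; exact h)
  have hC₀ : IsCycleSet ends {e | e = c ∨ ∃ i < n, D i = e} :=
    hP.isCycleSet hn (by rw [hc, Sym2.eq_swap, hP0]) hDc
  have hfree : ∀ i ≤ n + 1, ∀ C, IsCycleSet (splitAt ends c (P n)) C →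
      ¬ OnEdgeSet (splitAt ends c (P n)) C (X i) := by
    intro i hi C hC hon
    obtain ⟨hcC, hC', hv⟩ := hC.of_splitAt hc
    obtain ⟨v, hXv, hv⟩ := hv _ hon
    rcases hi.lt_or_eq with hi | rfl
    · rw [hXP i (by omega)] at hXv
      obtain rfl := Option.some_injective _ hXv
      refine hb C _ hC' hC₀ (fun h => hcC (h ▸ Or.inl rfl)) (P i) ⟨hv, ?_⟩
      rcases (Nat.lt_succ_iff.1 hi).lt_or_eq with hi | rfl
      · exact ⟨D i, Or.inr ⟨i, hi, rfl⟩, by simp [hP.ends_eq i hi]⟩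
      · exact ⟨c, Or.inl rfl, by simp [hc]⟩
    · rw [hXn] at hXv
      exact absurd hXv.symm (Option.some_ne_none v)
  have heY : ∃ i < n + 1, Y i = e := by
    rcases he with rfl | ⟨i, hi, rfl⟩
    · exact ⟨n, n.lt_succ_self, hYn⟩
    · exact ⟨i, by omega, hYD i hi⟩
  have hsc : s = none ∨ s = some v₀ := by
    rcases s with _ | s
    · exact Or.inl rfl
    · exact Or.inr (congrArg some hs)
  refine ⟨s, isDPSystem_splitAt hD hc hk s, ?_, hlate', ?_, ?_⟩
  · rintro C₁ C₂ h₁ h₂ hne o ⟨ho₁, ho₂⟩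
    obtain ⟨-, h₁', hv₁⟩ := h₁.of_splitAt hc
    obtain ⟨-, h₂', hv₂⟩ := h₂.of_splitAt hc
    obtain ⟨v, rfl, hv⟩ := hv₁ _ ho₁
    obtain ⟨w, hw, hw'⟩ := hv₂ _ ho₂
    obtain rfl := Option.some_injective _ hw
    exact hb C₁ C₂ h₁' h₂' hne v ⟨hv, hw'⟩
  · rw [degree, Set.ncard_eq_one]
    rcases hsc with rfl | rfl
    · exact ⟨c, Set.ext fun f => none_mem_splitAt_iff⟩
    · refine ⟨D 0, Set.ext fun f => (some_mem_splitAt_iff hvn).trans ⟨fun h => ?_, ?_⟩⟩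
      · exact (hdeg f h.2).resolve_left h.1
      · rintro rfl
        exact ⟨hDc 0 hn, by simp [hP.ends_eq 0 hn, hP0]⟩
  · rcases hsc with rfl | rfl
    · obtain ⟨i, hi, hie⟩ := heY
      refine ⟨_, _, n + 1, hX.reverse, hXn, ⟨n - i, by omega, ?_⟩, fun j hj => hfree _ (by omega)⟩
      rw [← hie]
      congr 1
      omega
    · exact ⟨X, Y, n + 1, hX, hX0, heY, fun i hi => hfree i hi.le⟩

/-- A system on a bead graph whose initial vertex is the start of a handle containing `e`, with
everything else attached to the other end, yields a reducible system. -/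
theorem IsHandle.exists_isReducible [Finite E] (hl : ∀ e, 0 < l e) {p : ℕ → V} {d : ℕ → E} {m : ℕ}
    (h : IsHandle ends p d m) (hD : IsDPSystem ends {p 0}) (hb : IsBead ends) {e : E} {i₀ : ℕ}
    (hi₀ : i₀ < m) (he : d i₀ = e) (hlate : HasLatePhase ends l (p 0) e τ)
    (hoff : ∀ f a, ends f = s(p 0, a) → Reach ends {g | p 0 ∉ ends g} (p m) a) :
    ∃ (W : Type) (ends' : E → Sym2 W) (w₀ : W), IsReducible ends' l w₀ e τ := by
  have hd0 := h.isSimplePath.ends_eq 0 h.pos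
  have h0 : p 0 ∈ ends (d 0) := by simp [hd0]
  have hpath : ∀ f, p 0 ∈ ends f → f ≠ d 0 → ∃ P D n, IsSimplePath ends P D n ∧ 0 < n ∧
      P 0 = p 0 ∧ P n = p 1 ∧ D 0 = f ∧ ∀ i < n, D i ≠ d 0 := by
    intro f hf hfd
    obtain ⟨b, hb⟩ := Sym2.mem_iff_exists.1 hf
    exact exists_path_of_reach_off hD.2.1 hfd hb hd0
      ((hoff f b hb).symm.trans (h.reach_off_zero h.pos one_pos))
  by_cases hf : ∃ f, p 0 ∈ ends f ∧ f ≠ d 0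
  · obtain ⟨f, hf, hfd⟩ := hf
    obtain ⟨P, D, n, hP, hn, hP0, hPn, rfl, hDd⟩ := hpath f hf hfd
    have hC := hP.isCycleSet hn (c := d 0) (by rw [hd0, Sym2.eq_swap, hPn, hP0]) hDd
    have hmem : ∀ g, p 0 ∈ ends g → g = d 0 ∨ g = D 0 := by
      intro g hg
      by_contra! hcon
      obtain ⟨P', D', n', hP', hn', hP0', hPn', rfl, hDd'⟩ := hpath g hg hcon.1
      have hC' := hP'.isCycleSet hn' (c := d 0) (by rw [hd0, Sym2.eq_swap, hPn', hP0']) hDd'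
      have hg' : D' 0 ∈ {e | e = d 0 ∨ ∃ i < n, D i = e} := by
        by_contra hno
        refine hb _ _ hC hC' (fun hCC => hno (hCC ▸ Or.inr ⟨0, hn', rfl⟩)) (p 0)
          ⟨⟨d 0, Or.inl rfl, h0⟩, ⟨d 0, Or.inl rfl, h0⟩⟩
      rcases hg' with hg' | ⟨i, hi, hg'⟩
      · exact hcon.1 hg'
      · rw [← hg', ← hP0] at hg
        have := (hP.mem_ends_iff (Nat.zero_le n) hi).1 hg
        obtain rfl : i = 0 := by omega
        exact hcon.2 hg'.symm
    have heC : e = d 0 ∨ ∃ i < n, D i = e := by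
      have := (h.mem_iff hC hi₀).2 (Or.inl rfl)
      rwa [he] at this
    obtain ⟨s, hs⟩ := exists_isReducible_splitAt hl hD hb hlate hP hP0 hn hDd
      (by rw [hd0, hPn]) heC hmem
    exact ⟨_, _, s, hs⟩
  · push Not at hf
    refine ⟨V, ends, p 0, h.isReducible_of_degree_eq_one hD hb hi₀ he hlate ?_⟩
    rw [degree, Set.ncard_eq_one]
    exact ⟨d 0, Set.ext fun f => ⟨hf f, fun hfd => by rw [Set.mem_singleton_iff.1 hfd]; exact h0⟩⟩

end Split

/-- if `LSTDP(E)` contains a DP-system on a bead broom graph whose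
single initial vertex is a terminal vertex of the handle and whose handle
contains an edge of maximal edge stabilization time, then `LSTDP(E)` contains a
DP-system on a bead graph with all degrees at most three whose single initial
vertex has degree one. -/
theorem stmt4 {E : Type} [Fintype E] (l : E → ℕ) (hl : ∀ e, 0 < l e)
    (hyp : ∃ (V : Type) (ends : E → Sym2 V) (v₀ : V) (H : Set E),
      IsDPSystem ends {v₀} ∧ IsBead ends ∧
      IsMaxStab (fun e => (l e : ℝ)) ends {v₀} ∧
      IsPathSet ends H ∧
      (∃ x : V, IsHandleTerminal ends H x ∧
        ∀ y : V, OnEdgeSet ends H y → y ≠ x → degree ends y ≤ 2) ∧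
      IsHandleTerminal ends H v₀ ∧
      (∃ eₛ ∈ H, ∀ e' : E, edgeStabTime ends (fun e => (l e : ℝ)) {v₀} e'
          ≤ edgeStabTime ends (fun e => (l e : ℝ)) {v₀} eₛ)) :
    ∃ (V : Type) (ends : E → Sym2 V) (v₀ : V),
      IsDPSystem ends {v₀} ∧
      IsBead ends ∧
      IsMaxStab (fun e => (l e : ℝ)) ends {v₀} ∧
      (∀ x : V, degree ends x ≤ 3) ∧
      degree ends v₀ = 1 := by
  obtain ⟨V, ends, v₀, H, hD, hb, hmax, hH, hterm, hv₀, eₛ, heₛ, hes⟩ := hyp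
  obtain ⟨τ, hlate, hτ⟩ := exists_hasLatePhase_of_max hD hl hes
  obtain ⟨p, d, m, hh, rfl, hde, hdeg⟩ := exists_isHandle hD.2.1 hH hterm hv₀ heₛ
  obtain ⟨ends₁, hD₁, hb₁, hlate₁, hh₁, hoff₁⟩ :=
    hh.exists_reattach hl hD hb m.lt_succ_self hde hlate hdeg
  obtain ⟨W, ends₂, w₀, h₂⟩ :=
    hh₁.exists_isReducible hl hD₁ hb₁ m.lt_succ_self hde hlate₁ hoff₁
  obtain ⟨ends₃, h₃, hdeg₃⟩ := h₂.exists_degree_le_three hl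
  exact ⟨W, ends₃, w₀, h₃.isDPSystem, h₃.isBead,
    fun V' ends' S' hD' => ((hmax V' ends' S' hD').trans hτ).trans
      (h₃.hasLatePhase.le_stabTime h₃.isDPSystem hl),
    hdeg₃, h₃.degree_eq⟩
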